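/- arXiv:1905.12430 — 4 statements merged into one kernel-verified Lean document; each statement's English description precedes it below -/
import Mathlib

section
/- Let $n, O, m, w, U$ be positive integers, let $d$ be a non-negative integer, and let $G : \mathbb{R}^{O\times m} \to \mathbb{R}^{w\times U}$ be $\rho$-Lipschitz ($\rho \ge 0$) with respect to the norms $|x|_* = \sup_{i\le O} \big(\sum_{j=1}^m x_{ij}^2\big)^{1/2}$ on $\mathbb{R}^{O\times m}$ and $|x|_* = \sup_{i\le w} \big(\sum_{j=1}^U x_{ij}^2\big)^{1/2}$ on $\mathbb{R}^{w\times U}$. Write $|X|_* = \sup_{i\le n} |X_{i,\cdot}|_*$ for $X$ in $\mathbb{R}^{n\times O\times m}$ or $\mathbb{R}^{n\times w\times U}$. For $X \in \mathbb{R}^{n\times O\times d}$ and $A\in\mathbb{R}^{d\times m}$ let $XA\in\mathbb{R}^{n\times O\times m}$ be given by $(XA)_{u,i,j}=\sum_{o=1}^d X_{u,i,o}A_{o,j}$, and let $\|A\|_{2,1}$ be the sum of the Euclidean norms of the columns of $A$. For a subset $V$ of a normed space, let $\mathcal{N}(V,\varepsilon,\|\cdot\|)$ be the minimum cardinality of a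 set of points of the space such that every $v\in V$ is within distance $\varepsilon$ of one of them. Then for any $X \in \mathbb{R}^{n\times O\times d}$ with $\|X_{i,o,\cdot}\|_2 \le b$ for all $i, o$, any reference matrix $M \in \mathbb{R}^{d\times m}$, and any $a, \varepsilon > 0$, the following covering number is finite and $$\log \mathcal{N}\big(\{G(XA) : A \in \mathbb{R}^{d\times m},\ \|A-M\|_{2,1} \le a\},\ \varepsilon,\ |\cdot|_*\big) \le \frac{64\, a^2 b^2 \rho^2}{\varepsilon^2}\, \log_2\!\Big(\frac{8 a b \rho\, n m O}{\varepsilon} + 7\, O m n\Big),$$ where $\log$ is the natural logarithm and $G$ is applied to each of the $n$ slices of $XA$. -/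
open scoped NNReal

noncomputable section

/-- The space `ℝ^{p×c}` (`p` spatial positions, `c` channels) with the norm `|·|_*`: the supremum
over positions of the Euclidean norm over channels (`starSpace_norm_eq` below). -/
abbrev StarSpace (p c : ℕ) : Type := Fin p → EuclideanSpace ℝ (Fin c)

theorem starSpace_norm_eq {p c : ℕ} (x : StarSpace p c) :
    ‖x‖ = ⨆ i : Fin p, Real.sqrt (∑ j : Fin c, x i j ^ 2) := by
  rw [Pi.norm_def]
  rcases isEmpty_or_nonempty (Fin p) with h | h
  · simp [Finset.univ_eq_empty]
  · rw [← Finset.sup'_eq_sup Finset.univ_nonempty, Finset.sup'_univ_eq_ciSup, NNReal.coe_iSup]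
    exact iSup_congr fun i => by simp [EuclideanSpace.norm_eq]

/-- The space `ℝ^{n×p×c}` with the norm `|X|_* = sup_{i ≤ n} |X_{i,·}|_*`. -/
abbrev StarTensor (n p c : ℕ) : Type := Fin n → StarSpace p c

/-- The product `(XA)_{u,i,j} = ∑_o X_{u,i,o} A_{o,j}` of a tensor and a matrix. -/
def tensorMul {n O d m : ℕ} (X : StarTensor n O d) (A : Matrix (Fin d) (Fin m) ℝ) :
    StarTensor n O m :=
  fun u i => WithLp.toLp 2 fun j => ∑ o : Fin d, X u i o * A o j

/-- `‖A‖_{2,1}`: the sum over the columns of their Euclidean norms. -/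
def norm21 {d m : ℕ} (A : Matrix (Fin d) (Fin m) ℝ) : ℝ :=
  ∑ j : Fin m, Real.sqrt (∑ o : Fin d, A o j ^ 2)

/-- The class `{G(XA) : ‖A - M‖_{2,1} ≤ a}`, with `G` applied to each of the `n` slices of `XA`. -/
def layerClass {n O d m w U : ℕ} (G : StarSpace O m → StarSpace w U) (X : StarTensor n O d)
    (M : Matrix (Fin d) (Fin m) ℝ) (a : ℝ) : Set (StarTensor n w U) :=
  {Y | ∃ A : Matrix (Fin d) (Fin m) ℝ, norm21 (A - M) ≤ a ∧ Y = fun u => G (tensorMul X A u)}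

end

section GreedyApproximation

open scoped Pointwise

variable {ι E F : Type*} [NormedAddCommGroup E] [InnerProductSpace ℝ E]
  [AddCommGroup F] [DecidableEq F]

/-- Perceptron-type approximation: greedy steps `± η • x i` bring all the correlations
`⟪v - y, x i⟫` below `τ`, and every step decreases the squared distance to `v` by `η * τ`. -/
theorem exists_greedy_approximation (x : ι → E) {b τ η : ℝ} (hx : ∀ i, ‖x i‖ ≤ b)
    (hη : 0 < η) (hτ : 0 < τ) (hητ : η * b ^ 2 ≤ τ) (φ : E →+ F) (S : Finset F)
    (hpos : ∀ i, φ (η • x i) ∈ S) (hneg : ∀ i, φ (-(η • x i)) ∈ S) (v : E) :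
    ∃ (T : ℕ) (y : E), T * (η * τ) ≤ ‖v‖ ^ 2 ∧ φ y ∈ T • S ∧
      ∀ i, |inner ℝ (v - y) (x i)| ≤ τ := by
  have hητ0 : 0 < η * τ := mul_pos hη hτ
  obtain ⟨k, hk⟩ : ∃ k : ℕ, ‖v‖ ^ 2 ≤ k * (η * τ) := by
    obtain ⟨k, hk⟩ := exists_nat_ge (‖v‖ ^ 2 / (η * τ))
    exact ⟨k, (div_le_iff₀ hητ0).1 hk⟩
  induction k generalizing v with
  | zero =>
    have hv : v = 0 := by
      have : ‖v‖ ^ 2 = 0 := le_antisymm (by simpa using hk) (sq_nonneg _)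
      simpa using this
    subst hv
    exact ⟨0, 0, by simp, by simp, fun i => by simpa using hτ.le⟩
  | succ k ih =>
    by_cases hv : ∀ i, |inner ℝ v (x i)| ≤ τ
    · exact ⟨0, 0, by simp, by simp, by simpa using hv⟩
    push Not at hv
    obtain ⟨i, hi⟩ := hv
    obtain ⟨z, hzS, hz⟩ : ∃ z : E, φ z ∈ S ∧ ‖v - z‖ ^ 2 + η * τ ≤ ‖v‖ ^ 2 := by
      have hxi : ‖x i‖ ^ 2 ≤ b ^ 2 := pow_le_pow_left₀ (norm_nonneg _) (hx i) 2
      have hxi' : η * (η * ‖x i‖ ^ 2) ≤ η * τ :=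
        mul_le_mul_of_nonneg_left
          ((mul_le_mul_of_nonneg_left hxi hη.le).trans hητ) hη.le
      have hnorm : ‖η • x i‖ ^ 2 = η * (η * ‖x i‖ ^ 2) := by
        rw [norm_smul, Real.norm_eq_abs, mul_pow, sq_abs]; ring
      rcases lt_abs.1 hi with h | h
      · refine ⟨η • x i, hpos i, ?_⟩
        rw [norm_sub_sq_real, hnorm, inner_smul_right]
        nlinarith
      · refine ⟨-(η • x i), hneg i, ?_⟩
        rw [sub_neg_eq_add, norm_add_sq_real, hnorm, inner_smul_right]
        nlinarith
    obtain ⟨T, y, hT, hy, hyx⟩ := ih (v - z) (by push_cast at hk; linarith)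
    refine ⟨T + 1, y + z, by push_cast; linarith, ?_, fun i => ?_⟩
    · rw [succ_nsmul, map_add]
      exact Finset.add_mem_add hy hzS
    · rw [show v - (y + z) = v - z - y by abel]
      exact hyx i

/-- Approximation of one vector with a step size taken from the grid
`{δ * l / (r * b ^ 2) : 1 ≤ l ≤ ⌊r⌋}`, where `r = a * b / δ`. -/
theorem exists_greedy_approximation_of_grid (x : ι → E) {a b δ r : ℝ} (hx : ∀ i, ‖x i‖ ≤ b)
    (ha : 0 < a) (hb : 0 < b) (hδ : 0 < δ) (hr : r = a * b / δ) (φ : E →+ F) (S : Finset F)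
    (hpos : ∀ i, ∀ l < ⌊r⌋₊, φ ((δ * (l + 1 : ℕ) / (r * b ^ 2)) • x i) ∈ S)
    (hneg : ∀ i, ∀ l < ⌊r⌋₊, φ (-((δ * (l + 1 : ℕ) / (r * b ^ 2)) • x i)) ∈ S)
    (v : E) (hv : ‖v‖ ≤ a) :
    ∃ (T : ℕ) (y : E), T ≤ 2 * r ^ 2 * (‖v‖ / a) ∧ φ y ∈ T • S ∧
      ∀ i, inner ℝ (v - y) (x i) ^ 2 ≤ δ ^ 2 * (‖v‖ / a) := by
  have hr0 : 0 < r := hr ▸ by positivity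
  have hrδ : r * δ = a * b := by rw [hr]; field_simp
  set p := ‖v‖ / a with hp
  have hp0 : 0 ≤ p := by positivity
  have hvp : ‖v‖ = a * p := by rw [hp]; field_simp
  have hp1 : p ≤ 1 := (div_le_one ha).2 hv
  set q := r * √p with hq
  have hq0 : 0 ≤ q := by positivity
  have hq2 : q ^ 2 = r ^ 2 * p := by rw [hq, mul_pow, Real.sq_sqrt hp0]
  have hqr : q ≤ r := by
    rw [hq]
    exact mul_le_of_le_one_right hr0.le (Real.sqrt_le_one.2 hp1)
  rcases lt_or_ge q 1 with h1 | h1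
  · refine ⟨0, 0, by simpa using by positivity, by simp, fun i => ?_⟩
    have h2 : r ^ 2 * p ≤ 1 := by rw [← hq2]; nlinarith
    have h3 : |inner ℝ v (x i)| ≤ a * p * b := by
      rw [← hvp]
      exact (abs_real_inner_le_norm _ _).trans
        (mul_le_mul_of_nonneg_left (hx i) (norm_nonneg _))
    rw [sub_zero, ← sq_abs]
    calc |inner ℝ v (x i)| ^ 2 ≤ (a * p * b) ^ 2 := pow_le_pow_left₀ (abs_nonneg _) h3 2
      _ = (a * b) ^ 2 * p * p := by ring
      _ = δ ^ 2 * p * (r ^ 2 * p) := by rw [← hrδ]; ring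
      _ ≤ δ ^ 2 * p := mul_le_of_le_one_right (by positivity) h2
  · have hl1 : 1 ≤ ⌊q⌋₊ := (Nat.one_le_floor_iff _).2 h1
    obtain ⟨l, hl⟩ : ∃ l, ⌊q⌋₊ = l + 1 := ⟨⌊q⌋₊ - 1, by omega⟩
    have hlr : l < ⌊r⌋₊ := by
      have := Nat.floor_mono hqr
      omega
    have hlq : ((l + 1 : ℕ) : ℝ) ≤ q := hl ▸ Nat.floor_le hq0
    have hql : q ≤ 2 * ((l + 1 : ℕ) : ℝ) := by
      have h2 : q < ((l + 1 : ℕ) : ℝ) + 1 := hl ▸ Nat.lt_floor_add_one q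
      have h3 : (1 : ℝ) ≤ ((l + 1 : ℕ) : ℝ) := by exact_mod_cast hl ▸ hl1
      linarith
    have hL0 : (0 : ℝ) < ((l + 1 : ℕ) : ℝ) := by positivity
    set L : ℝ := ((l + 1 : ℕ) : ℝ)
    obtain ⟨T, y, hT, hy, hyx⟩ := exists_greedy_approximation x (τ := δ * q / r)
      (η := δ * L / (r * b ^ 2)) hx (by positivity) (by positivity)
      (by
        rw [show δ * L / (r * b ^ 2) * b ^ 2 = δ * L / r by field_simp]
        gcongr) φ S (fun i => hpos i l hlr) (fun i => hneg i l hlr) v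
    refine ⟨T, y, ?_, hy, fun i => ?_⟩
    · have hstep : a ^ 2 * p / (2 * r ^ 2) ≤ δ * L / (r * b ^ 2) * (δ * q / r) := by
        have e1 : δ * L / (r * b ^ 2) * (δ * q / r) = δ ^ 2 * (L * q) / (r ^ 2 * b ^ 2) := by
          field_simp
        have e2 : a ^ 2 * p / (2 * r ^ 2) = δ ^ 2 * (q ^ 2 / 2) / (r ^ 2 * b ^ 2) := by
          rw [hq2, show δ ^ 2 * (r ^ 2 * p / 2) = (r * δ) ^ 2 * p / 2 by ring, hrδ]
          field_simp
        rw [e1, e2]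
        gcongr
        nlinarith
      have hp' : 0 < p := by
        by_contra h
        have : p = 0 := le_antisymm (not_lt.1 h) hp0
        rw [this] at hq2
        nlinarith
      have h4 : T * (a ^ 2 * p / (2 * r ^ 2)) ≤ (a * p) ^ 2 :=
        (mul_le_mul_of_nonneg_left hstep (Nat.cast_nonneg T)).trans (hvp ▸ hT)
      have h5 : 0 < a ^ 2 * p / (2 * r ^ 2) := by positivity
      refine le_of_mul_le_mul_right (h4.trans_eq ?_) h5
      field_simp
    · rw [← sq_abs]
      calc |inner ℝ (v - y) (x i)| ^ 2 ≤ (δ * q / r) ^ 2 :=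
            pow_le_pow_left₀ (abs_nonneg _) (hyx i) 2
        _ = δ ^ 2 * p := by
            rw [div_pow, mul_pow, hq2]
            field_simp

theorem Finset.sum_mem_sum_nsmul {κ : Type*} (s : Finset κ) (S : Finset F) (T : κ → ℕ)
    (f : κ → F) (h : ∀ j ∈ s, f j ∈ T j • S) : ∑ j ∈ s, f j ∈ (∑ j ∈ s, T j) • S := by
  classical
  induction s using Finset.induction_on with
  | empty => simp
  | insert j s hj ih =>
    rw [Finset.sum_insert hj, Finset.sum_insert hj, add_nsmul]
    exact Finset.add_mem_add (h j (by simp)) (ih fun k hk => h k (by simp [hk]))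

/-- A finite net for the ball `∑ j, ‖A j‖ ≤ a`, in the seminorm
`sup_i (∑ j, ⟪A j, x i⟫ ^ 2) ^ (1 / 2)`. -/
theorem exists_finset_net_sum_norm_le [Fintype ι] {κ : Type*} [Fintype κ] [DecidableEq κ]
    (x : ι → E) {a b δ r : ℝ} (hx : ∀ i, ‖x i‖ ≤ b)
    (ha : 0 < a) (hb : 0 < b) (hδ : 0 < δ) (hr : r = a * b / δ) :
    ∃ C : Finset (κ → E),
      C.card ≤ (2 * Fintype.card ι * Fintype.card κ * ⌊r⌋₊ + 1) ^ ⌊2 * r ^ 2⌋₊ ∧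
      ∀ A : κ → E, ∑ j, ‖A j‖ ≤ a →
        ∃ B ∈ C, ∀ i, ∑ j, inner ℝ (A j - B j) (x i) ^ 2 ≤ δ ^ 2 := by
  classical
  let step : κ × ι × Fin ⌊r⌋₊ → E := fun t => (δ * (t.2.2 + 1 : ℕ) / (r * b ^ 2)) • x t.2.1
  let g : Bool × κ × ι × Fin ⌊r⌋₊ → κ → E := fun t =>
    Pi.single t.2.1 (if t.1 then step t.2 else -step t.2)
  let S : Finset (κ → E) := insert 0 (Finset.univ.image g)
  have hScard : S.card ≤ 2 * Fintype.card ι * Fintype.card κ * ⌊r⌋₊ + 1 := by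
    refine (Finset.card_insert_le _ _).trans (Nat.succ_le_succ ?_)
    refine Finset.card_image_le.trans_eq ?_
    simp only [Finset.card_univ, Fintype.card_prod, Fintype.card_bool, Fintype.card_fin]
    ring
  have hg : ∀ t, g t ∈ S := fun t =>
    Finset.mem_insert_of_mem (Finset.mem_image_of_mem _ (Finset.mem_univ _))
  refine ⟨⌊2 * r ^ 2⌋₊ • S, ?_, fun A hA => ?_⟩
  · exact Finset.card_nsmul_le.trans (Nat.pow_le_pow_left hScard _)
  have hAj : ∀ j, ‖A j‖ ≤ a := fun j =>
    (Finset.single_le_sum (f := fun j => ‖A j‖) (fun _ _ => norm_nonneg _)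
      (Finset.mem_univ j)).trans hA
  have key := fun j => exists_greedy_approximation_of_grid x hx ha hb hδ hr
    (AddMonoidHom.single (fun _ : κ => E) j) S
    (fun i l hl => by simpa [g, step] using hg (true, j, i, ⟨l, hl⟩))
    (fun i l hl => by simpa [g, step] using hg (false, j, i, ⟨l, hl⟩)) (A j) (hAj j)
  choose T B hT hB hBx using key
  have hsum : (∑ j, ‖A j‖) / a ≤ 1 := (div_le_one ha).2 hA
  refine ⟨B, ?_, fun i => ?_⟩
  · have hmem := Finset.sum_mem_sum_nsmul Finset.univ S T
      (fun j => Pi.single j (B j)) (fun j _ => hB j)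
    rw [Finset.univ_sum_single] at hmem
    refine Finset.nsmul_subset_nsmul_right (Finset.mem_insert_self _ _) (Nat.le_floor ?_) hmem
    push_cast
    calc ∑ j, (T j : ℝ) ≤ ∑ j, 2 * r ^ 2 * (‖A j‖ / a) := Finset.sum_le_sum fun j _ => hT j
      _ = 2 * r ^ 2 * ((∑ j, ‖A j‖) / a) := by rw [← Finset.mul_sum, Finset.sum_div]
      _ ≤ 2 * r ^ 2 := mul_le_of_le_one_right (by positivity) hsum
  · calc ∑ j, inner ℝ (A j - B j) (x i) ^ 2 ≤ ∑ j, δ ^ 2 * (‖A j‖ / a) :=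
          Finset.sum_le_sum fun j _ => hBx j i
      _ = δ ^ 2 * ((∑ j, ‖A j‖) / a) := by rw [← Finset.mul_sum, Finset.sum_div]
      _ ≤ δ ^ 2 := mul_le_of_le_one_right (by positivity) hsum

end GreedyApproximation

/-- The columns of a matrix, as Euclidean vectors. -/
def matrixColumns {d m : ℕ} (A : Matrix (Fin d) (Fin m) ℝ) : Fin m → EuclideanSpace ℝ (Fin d) :=
  fun j => WithLp.toLp 2 fun o => A o j

/-- The matrix with the given columns. -/
def matrixOfColumns {d m : ℕ} (B : Fin m → EuclideanSpace ℝ (Fin d)) :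
    Matrix (Fin d) (Fin m) ℝ :=
  fun o j => B j o

theorem norm21_eq_sum_norm_matrixColumns {d m : ℕ} (A : Matrix (Fin d) (Fin m) ℝ) :
    norm21 A = ∑ j, ‖matrixColumns A j‖ := by
  simp [norm21, matrixColumns, EuclideanSpace.norm_eq]

theorem dist_tensorMul_le {n O d m : ℕ} (X : StarTensor n O d)
    (A M : Matrix (Fin d) (Fin m) ℝ) (B : Fin m → EuclideanSpace ℝ (Fin d)) {δ : ℝ} (hδ : 0 ≤ δ)
    (h : ∀ u i, ∑ j, inner ℝ (matrixColumns (A - M) j - B j) (X u i) ^ 2 ≤ δ ^ 2) :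
    dist (tensorMul X A) (tensorMul X (M + matrixOfColumns B)) ≤ δ := by
  refine (dist_pi_le_iff hδ).2 fun u => (dist_pi_le_iff hδ).2 fun i => ?_
  rw [EuclideanSpace.dist_eq]
  refine Real.sqrt_le_iff.2 ⟨hδ, le_of_eq_of_le (Finset.sum_congr rfl fun j _ => ?_) (h u i)⟩
  rw [Real.dist_eq, sq_abs]
  congr 1
  simp only [tensorMul, matrixColumns, matrixOfColumns, PiLp.inner_apply, PiLp.sub_apply,
    Matrix.add_apply, Matrix.sub_apply, RCLike.inner_apply, conj_trivial,
    ← Finset.sum_sub_distrib]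
  exact Finset.sum_congr rfl fun o _ => by ring

/-- A net for the columns of `A - M` gives a cover of the layer class. -/
theorem externalCoveringNumber_layerClass_le_card {n O d m w U : ℕ} {ρ : ℝ≥0}
    {G : StarSpace O m → StarSpace w U} (hG : LipschitzWith ρ G) (X : StarTensor n O d)
    (M : Matrix (Fin d) (Fin m) ℝ) {a δ : ℝ} {ε : ℝ≥0} (hδ : 0 ≤ δ) (hε : ρ * δ ≤ ε)
    (C : Finset (Fin m → EuclideanSpace ℝ (Fin d)))
    (hC : ∀ A : Fin m → EuclideanSpace ℝ (Fin d), ∑ j, ‖A j‖ ≤ a →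
      ∃ B ∈ C, ∀ u i, ∑ j, inner ℝ (A j - B j) (X u i) ^ 2 ≤ δ ^ 2) :
    Metric.externalCoveringNumber ε (layerClass G X M a) ≤ C.card := by
  classical
  let c : (Fin m → EuclideanSpace ℝ (Fin d)) → StarTensor n w U :=
    fun B u => G (tensorMul X (M + matrixOfColumns B) u)
  have hcover : Metric.IsCover ε (layerClass G X M a) (C.image c : Set (StarTensor n w U)) := by
    rintro Y ⟨A, hA, rfl⟩
    obtain ⟨B, hB, hAB⟩ := hC (matrixColumns (A - M)) (norm21_eq_sum_norm_matrixColumns _ ▸ hA)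
    refine ⟨c B, Finset.mem_coe.2 (Finset.mem_image_of_mem c hB), ?_⟩
    change edist _ _ ≤ (ε : ENNReal)
    rw [edist_nndist, ENNReal.coe_le_coe, ← NNReal.coe_le_coe, coe_nndist]
    refine (dist_pi_le_iff ε.coe_nonneg).2 fun u => (hG.dist_le_mul _ _).trans (le_trans ?_ hε)
    exact mul_le_mul_of_nonneg_left
      ((dist_le_pi_dist _ _ u).trans (dist_tensorMul_le X A M B hδ hAB)) ρ.coe_nonneg
  refine hcover.externalCoveringNumber_le_encard.trans ?_
  rw [Set.encard_coe_eq_coe_finsetCard]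
  exact_mod_cast Finset.card_image_le

theorem sum_inner_sq_le {E κ : Type*} [NormedAddCommGroup E] [InnerProductSpace ℝ E] [Fintype κ]
    (A : κ → E) (x : E) {a b : ℝ} (hA : ∑ j, ‖A j‖ ≤ a) (hx : ‖x‖ ≤ b) :
    ∑ j, inner ℝ (A j) x ^ 2 ≤ (a * b) ^ 2 := by
  have hA0 : 0 ≤ ∑ j, ‖A j‖ := Finset.sum_nonneg fun _ _ => norm_nonneg _
  calc ∑ j, inner ℝ (A j) x ^ 2 = ∑ j, |inner ℝ (A j) x| ^ 2 := by simp only [sq_abs]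
    _ ≤ (∑ j, |inner ℝ (A j) x|) ^ 2 :=
        Finset.sum_sq_le_sq_sum_of_nonneg fun _ _ => abs_nonneg _
    _ ≤ (∑ j, ‖A j‖ * ‖x‖) ^ 2 := by
        gcongr with j
        exact abs_real_inner_le_norm _ _
    _ = ((∑ j, ‖A j‖) * ‖x‖) ^ 2 := by rw [Finset.sum_mul]
    _ ≤ (a * b) ^ 2 := by
        gcongr
        exact hA0.trans hA

/-- Covering numbers of one layer followed by a `ρ`-Lipschitz nonlinearity. The covering number is
the external one (centres anywhere in `ℝ^{n×w×U}`); it takes values in `ℕ∞`, and its finiteness is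
part of the claim. -/
theorem one_layer_covering_with_nonlinearity
    (n O m w U d : ℕ) (hn : 0 < n) (hO : 0 < O) (hm : 0 < m) (hw : 0 < w) (hU : 0 < U)
    (ρ : ℝ≥0) (G : StarSpace O m → StarSpace w U) (hG : LipschitzWith ρ G)
    (b : ℝ) (X : StarTensor n O d) (hX : ∀ i o, ‖X i o‖ ≤ b)
    (M : Matrix (Fin d) (Fin m) ℝ)
    (a : ℝ) (ha : 0 < a) (ε : ℝ≥0) (hε : 0 < ε) :
    Metric.externalCoveringNumber ε (layerClass G X M a) ≠ ⊤ ∧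
    Real.log ((Metric.externalCoveringNumber ε (layerClass G X M a)).toNat : ℝ) ≤
      64 * a ^ 2 * b ^ 2 * (ρ : ℝ) ^ 2 / (ε : ℝ) ^ 2 *
        Real.logb 2 (8 * a * b * (ρ : ℝ) * n * m * O / (ε : ℝ) + 7 * O * m * n) := by
  have hb : 0 ≤ b := (norm_nonneg _).trans (hX ⟨0, hn⟩ ⟨0, hO⟩)
  have hε' : (0 : ℝ) < ε := hε
  set r : ℝ := a * b * ρ / ε with hr
  have hr0 : 0 ≤ r := by positivity
  have hN : (1 : ℝ) ≤ n * O * m := by exact_mod_cast Nat.mul_pos (Nat.mul_pos hn hO) hm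
  set N : ℝ := n * O * m with hNdef
  have hrhs : 64 * a ^ 2 * b ^ 2 * (ρ : ℝ) ^ 2 / (ε : ℝ) ^ 2 *
        Real.logb 2 (8 * a * b * (ρ : ℝ) * n * m * O / (ε : ℝ) + 7 * O * m * n) =
      64 * r ^ 2 * Real.logb 2 (8 * r * N + 7 * N) := by
    rw [hr, hNdef]
    congr 1
    · ring
    · congr 1
      ring
  rw [hrhs]
  have hZ : 1 ≤ 8 * r * N + 7 * N := by nlinarith [mul_nonneg hr0 (zero_le_one.trans hN)]
  set Z := 8 * r * N + 7 * N with hZdef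
  have hlogZ : 0 ≤ Real.log Z := Real.log_nonneg hZ
  have hlogb : Real.log Z ≤ Real.logb 2 Z :=
    le_div_self hlogZ (Real.log_pos one_lt_two) (Real.log_two_lt_d9.le.trans (by norm_num))
  suffices h : ∃ C : ℕ, Metric.externalCoveringNumber ε (layerClass G X M a) ≤ C ∧
      Real.log C ≤ 2 * r ^ 2 * Real.log Z by
    obtain ⟨C, hC, hlog⟩ := h
    have htop := ne_top_of_le_ne_top (ENat.natCast_ne_top C) hC
    refine ⟨htop, ?_⟩
    have hle : Real.log ((Metric.externalCoveringNumber ε (layerClass G X M a)).toNat : ℝ) ≤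
        Real.log C := by
      rcases Nat.eq_zero_or_pos
        (Metric.externalCoveringNumber ε (layerClass G X M a)).toNat with h0 | h0
      · rw [h0, Nat.cast_zero, Real.log_zero]
        exact Real.log_natCast_nonneg C
      · refine Real.log_le_log (by exact_mod_cast h0) ?_
        exact_mod_cast ENat.toNat_le_of_le_natCast hC
    refine hle.trans (hlog.trans ?_)
    exact mul_le_mul (by nlinarith [sq_nonneg r]) hlogb hlogZ (by positivity)
  rcases le_or_gt (a * b * ρ) ε with hsmall | hlarge
  · refine ⟨1, ?_, by simpa using by positivity⟩
    have := externalCoveringNumber_layerClass_le_card (ε := ε) hG X M (a := a) (δ := a * b)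
      (by positivity) (by linarith) {0} (fun A hA => ⟨0, by simp, fun u i => by
        simpa using sum_inner_sq_le A (X u i) hA (hX u i)⟩)
    simpa using this
  · have hρ : (0 : ℝ) < ρ := by
      refine lt_of_le_of_ne ρ.coe_nonneg fun h => ?_
      rw [← h, mul_zero] at hlarge
      linarith
    have hb' : 0 < b := by
      refine lt_of_le_of_ne hb fun h => ?_
      rw [← h, mul_zero, zero_mul] at hlarge
      linarith
    have hδ : 0 < (ε : ℝ) / ρ := by positivity
    obtain ⟨C, hCcard, hC⟩ := exists_finset_net_sum_norm_le (κ := Fin m)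
      (fun t : Fin n × Fin O => X t.1 t.2) (fun t => hX t.1 t.2) ha hb' hδ
      (show r = a * b / ((ε : ℝ) / ρ) by rw [hr]; field_simp)
    refine ⟨C.card, externalCoveringNumber_layerClass_le_card hG X M hδ.le
      (by rw [mul_div_cancel₀ _ hρ.ne']) C fun A hA => ?_, ?_⟩
    · obtain ⟨B, hB, h⟩ := hC A hA
      exact ⟨B, hB, fun u i => h (u, i)⟩
    simp only [Fintype.card_prod, Fintype.card_fin] at hCcard
    have hfl : (⌊r⌋₊ : ℝ) ≤ r := Nat.floor_le hr0
    have hbase : ((2 * (n * O) * m * ⌊r⌋₊ + 1 : ℕ) : ℝ) ≤ Z := by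
      push_cast
      rw [show (2 * ((n : ℝ) * O) * m * ⌊r⌋₊ + 1) = 2 * (N * ⌊r⌋₊) + 1 by rw [hNdef]; ring, hZdef]
      nlinarith [mul_le_mul_of_nonneg_left hfl (zero_le_one.trans hN),
        mul_nonneg hr0 (zero_le_one.trans hN)]
    have hCpow : (C.card : ℝ) ≤ Z ^ ⌊2 * r ^ 2⌋₊ := by
      refine le_trans (by exact_mod_cast hCcard)
        (pow_le_pow_left₀ (Nat.cast_nonneg _) hbase _)
    have hlogC : Real.log C.card ≤ ⌊2 * r ^ 2⌋₊ * Real.log Z := by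
      rw [← Real.log_pow]
      rcases Nat.eq_zero_or_pos C.card with h0 | h0
      · rw [h0, Nat.cast_zero, Real.log_zero]
        exact Real.log_nonneg (one_le_pow₀ hZ)
      · exact Real.log_le_log (by exact_mod_cast h0) hCpow
    exact hlogC.trans (mul_le_mul_of_nonneg_right (Nat.floor_le (by positivity)) hlogZ)
end

section
/- Let $L,n\in\mathbb N$ and $a_1,\dots,a_L>0$. Let $V_0,\dots,V_L$ be real vector spaces, each with two norms $|\cdot|_{\infty,l}$ and $|\cdot|_l$, let $B_1,\dots,B_L$ be real normed vector spaces, let $\mathcal B_l=\{A\in B_l:\|A\|\le a_l\}$, and let $F^l:V_{l-1}\times B_l\to V_l$, $(x,A)\mapsto F^l_A(x)$, be operators. For $\mathcal A=(A^1,\dots,A^L)$ and $0\le l_1\le l_2\le L$ write $F^{l_1\to l_2}_{\mathcal A}=F^{l_2}_{A^{l_2}}\circ\cdots\circ F^{l_1+1}_{A^{l_1+1}}:V_{l_1}\to V_{l_2}$ (the identity if $l_1=l_2$), and let $\rho^{\mathcal A}_{l_1\to l_2}\in[0,\infty]$ be the Lipschitz constant of $F^{l_1\to l_2}_{\mathcal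 A}$ with respect to $|\cdot|_{\infty,l_1}$ and $|\cdot|_{l_2}$. Assume that there are real numbers $C_{l,\eta,n}$ such that for all $l\in\{1,\dots,L\}$, all $\beta>0$, all $Z_1,\dots,Z_n\in V_{l-1}$ with $|Z_i|_{l-1}\le \beta$ for all $i$, and all $\eta>0$, there is a finite set $\mathcal C_l(\beta,Z,\eta)\subseteq\mathcal B_l$ with $$\log\#\mathcal C_l(\beta,Z,\eta)\le \frac{C_{l,\eta,n}\,a_l^2\beta^2}{\eta^2}$$ such that for every $A\in\mathcal B_l$ there is $\bar A\in\mathcal C_l(\beta,Z,\eta)$ with $|F^l_A(Z_i)-F^l_{\bar A}(Z_i)|_{\infty,l}\le\eta$ for all $i$. Let $0<\varepsilon<1$, let $b=(b_0,\dots,b_L)$ with $b_l\ge1$ for all $l$ and $b_L=1$, let $\rho_1,\dots,\rho_L>0$, and let $x_1,\dots,x_n\in V_0$ with $|x_i|_0\le b_0$ for all $i$. Let $K_1,\dots,K_L>0$ be such that $C_{l,\varepsilon_l,n}\le K_l$ for every $l$, where $$\varepsilon_l=\frac{\alpha_l\,\varepsilon}{\rho_l},\qquad \alpha_l=\frac{\big(K_l^{1/2}a_lb_{l-1}\rho_l\big)^{2/3}}{\sum_{j=1}^L\big(K_j^{1/2}a_jb_{j-1}\rho_j\big)^{2/3}}.$$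 (If the constants $C_{l,\eta,n}=C_{l,n}>0$ do not depend on $\eta$, one may take $K_l=C_{l,n}$; one may take $K_l=C_{l,\varepsilon,n}$ whenever these are positive and, for this choice, $C_{l,\varepsilon_l,n}\le C_{l,\varepsilon,n}$ for all $l$.) Then there exists a finite set $\mathcal C\subseteq\mathcal B_1\times\cdots\times\mathcal B_L$ such that: (i) for every $\mathcal A\in\mathcal B_1\times\cdots\times\mathcal B_L$ with $\rho^{\mathcal A}_{l_1\to l_2}\le\rho_{l_1}b_{l_2}$ for all $1\le l_1\le l_2\le L$, there exists $\bar{\mathcal A}\in\mathcal C$ such that for every $i$ with $|F^{0\to l}_{\mathcal A}(x_i)|_l\le b_l$ for all $0\le l\le L$, one has, for every $0\le l\le L$, $$\big|F^{0\to l}_{\mathcal A}(x_i)-F^{0\to l}_{\bar{\mathcal A}}(x_i)\big|_l\le\varepsilon b_l\qquad\text{and}\qquad\big|F^{0\to l}_{\bar{\mathcal A}}(x_i)\big|_l\le 2b_l;$$ (ii) $$\log\#\mathcal C\le 4\Big[\sum_{l=1}^L\Big(\frac{K_l^{1/2}a_lb_{l-1}\rho_l}{\varepsilon}\Big)^{2/3}\Big]^3\le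 \frac{4L^2}{\varepsilon^2}\sum_{l=1}^L\Big(\frac{K_l^{1/2}a_lb_{l-1}\rho_l}{\varepsilon}\Big)^2.$$ -/
open scoped ENNReal

/-- Layers are indexed from `0`: `l : Fin L` stands for the layer with input space `V l.castSucc`,
parameter space `B l` and output space `V l.succ`. For `l₁ ≤ l₂ ≤ L` and `𝒜 = (A l)_l`,
`subnet F A h h₂` is the composition of the layer maps `F l · (A l)`, `l₁ ≤ l < l₂`, from `V_{l₁}`
to `V_{l₂}`; it is the identity for `l₁ = l₂`. See `subnet_self` and `subnet_succ`. -/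
def subnet {L : ℕ} {V : Fin (L + 1) → Type*} {B : Fin L → Type*}
    (F : ∀ l : Fin L, V l.castSucc → B l → V l.succ) (A : ∀ l : Fin L, B l)
    {l₁ l₂ : ℕ} (h : l₁ ≤ l₂) (h₂ : l₂ < L + 1) : V ⟨l₁, h.trans_lt h₂⟩ → V ⟨l₂, h₂⟩ :=
  Nat.leRec (motive := fun m hm => (hL : m < L + 1) → V ⟨l₁, hm.trans_lt hL⟩ → V ⟨m, hL⟩)
    (fun _ x => x)
    (fun k _ f hL x => F ⟨k, Nat.lt_of_succ_lt_succ hL⟩ (f (Nat.lt_of_succ_lt hL) x)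
      (A ⟨k, Nat.lt_of_succ_lt_succ hL⟩))
    h h₂

theorem subnet_self {L : ℕ} {V : Fin (L + 1) → Type*} {B : Fin L → Type*}
    (F : ∀ l : Fin L, V l.castSucc → B l → V l.succ) (A : ∀ l : Fin L, B l)
    {l : ℕ} (hL : l < L + 1) (x : V ⟨l, hL⟩) : subnet F A le_rfl hL x = x := by
  unfold subnet
  rw [Nat.leRec_self]

theorem subnet_succ {L : ℕ} {V : Fin (L + 1) → Type*} {B : Fin L → Type*}
    (F : ∀ l : Fin L, V l.castSucc → B l → V l.succ) (A : ∀ l : Fin L, B l)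
    {l₁ k : ℕ} (h : l₁ ≤ k) (hk : k < L) (x : V ⟨l₁, by omega⟩) :
    subnet F A (Nat.le_succ_of_le h) (Nat.succ_lt_succ hk) x =
      F ⟨k, hk⟩ (subnet F A h (Nat.lt_succ_of_lt hk) x) (A ⟨k, hk⟩) := by
  unfold subnet
  rw [Nat.leRec_succ]

/-- The Lipschitz constant (possibly `∞`) of `f : E → E'` with respect to the norm `p` on `E` and
the norm `q` on `E'`. -/
noncomputable def lipConst {E E' : Type*} [AddCommGroup E] [Module ℝ E]
    [AddCommGroup E'] [Module ℝ E'] (p : Seminorm ℝ E) (q : Seminorm ℝ E') (f : E → E') : ℝ≥0∞ :=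
  sInf {K : ℝ≥0∞ | ∀ u v : E, ENNReal.ofReal (q (f u - f v)) ≤ K * ENNReal.ofReal (p (u - v))}

/-- The quantity `K_l^{1/2} a_l b_{l-1} ρ_l` of layer `l`. -/
noncomputable def layerSize {L : ℕ} (K a ρ : Fin L → ℝ) (b : Fin (L + 1) → ℝ) (l : Fin L) : ℝ :=
  Real.sqrt (K l) * a l * b l.castSucc * ρ l

/-- The accuracy `ε_l = α_l ε / ρ_l` used at layer `l`, where
`α_l = r_l^{2/3} / ∑_j r_j^{2/3}` and `r_l = K_l^{1/2} a_l b_{l-1} ρ_l`. -/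
noncomputable def layerAccuracy {L : ℕ} (ε : ℝ) (K a ρ : Fin L → ℝ) (b : Fin (L + 1) → ℝ)
    (l : Fin L) : ℝ :=
  (layerSize K a ρ b l ^ ((2 : ℝ) / 3) / ∑ j, layerSize K a ρ b j ^ ((2 : ℝ) / 3)) * ε / ρ l

theorem le_mul_of_lipConst_le {E E' : Type*} [AddCommGroup E] [Module ℝ E]
    [AddCommGroup E'] [Module ℝ E'] {p : Seminorm ℝ E} {q : Seminorm ℝ E'} {f : E → E'}
    {c : ℝ} (hc : 0 ≤ c) (h : lipConst p q f ≤ ENNReal.ofReal c) (u v : E) :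
    q (f u - f v) ≤ c * p (u - v) := by
  have key : ENNReal.ofReal (q (f u - f v)) ≤ ENNReal.ofReal c * ENNReal.ofReal (p (u - v)) := by
    have hlip : ENNReal.ofReal (q (f u - f v)) ≤ lipConst p q f * ENNReal.ofReal (p (u - v)) := by
      have hne : Nonempty {K : ℝ≥0∞ | ∀ u v : E,
          ENNReal.ofReal (q (f u - f v)) ≤ K * ENNReal.ofReal (p (u - v))} := by
        rw [Set.nonempty_coe_sort, Set.nonempty_iff_ne_empty]
        intro hempty
        rw [lipConst, hempty, sInf_empty, top_le_iff] at h
        exact ENNReal.ofReal_ne_top h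
      rw [lipConst, sInf_eq_iInf', ENNReal.iInf_mul fun htop => absurd htop ENNReal.ofReal_ne_top]
      exact le_iInf fun K => K.2 u v
    exact hlip.trans (by gcongr)
  rw [← ENNReal.ofReal_mul hc] at key
  exact (ENNReal.ofReal_le_ofReal_iff (mul_nonneg hc (apply_nonneg p _))).1 key

section Subnet

variable {L : ℕ} {V : Fin (L + 1) → Type*} {B : Fin L → Type*}
  (F : ∀ l : Fin L, V l.castSucc → B l → V l.succ)

theorem subnet_congr {A A' : ∀ l : Fin L, B l} {l₁ l₂ : ℕ} (h : l₁ ≤ l₂) (h₂ : l₂ < L + 1)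
    (hA : ∀ l : Fin L, (l : ℕ) < l₂ → A l = A' l) (x : V ⟨l₁, h.trans_lt h₂⟩) :
    subnet F A h h₂ x = subnet F A' h h₂ x := by
  induction l₂, h using Nat.le_induction with
  | base => rw [subnet_self, subnet_self]
  | succ k hk ih =>
    rw [subnet_succ F A hk (by omega), subnet_succ F A' hk (by omega),
      ih (by omega) (fun l hl => hA l (by omega)), hA ⟨k, by omega⟩ (Nat.lt_succ_self k)]

theorem subnet_eq_subnet_layer (A : ∀ l : Fin L, B l) {l₁ l₂ : ℕ} (h : l₁ + 1 ≤ l₂)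
    (h₂ : l₂ < L + 1) (x : V ⟨l₁, by omega⟩) :
    subnet F A (Nat.le_of_succ_le h) h₂ x =
      subnet F A h h₂ (F ⟨l₁, by omega⟩ x (A ⟨l₁, by omega⟩)) := by
  induction l₂, h using Nat.le_induction with
  | base =>
    rw [subnet_succ F A le_rfl (by omega), subnet_self, subnet_self]
  | succ k hk ih =>
    rw [subnet_succ F A hk (by omega), subnet_succ F A (Nat.le_of_succ_le hk) (by omega),
      ih (by omega)]

end Subnet

theorem filter_val_lt_succ {L : ℕ} (k : ℕ) (hk : k < L) :
    (Finset.univ.filter fun j : Fin L => (j : ℕ) < k + 1) =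
      insert ⟨k, hk⟩ (Finset.univ.filter fun j : Fin L => (j : ℕ) < k) := by
  ext j
  simp only [Finset.mem_filter, Finset.mem_univ, true_and, Finset.mem_insert, Fin.ext_iff]
  omega

theorem sum_filter_val_lt_succ {L : ℕ} (k : ℕ) (hk : k < L) (f : Fin L → ℝ) :
    ∑ j ∈ Finset.univ.filter (fun j : Fin L => (j : ℕ) < k + 1), f j =
      f ⟨k, hk⟩ + ∑ j ∈ Finset.univ.filter (fun j : Fin L => (j : ℕ) < k), f j := by
  rw [filter_val_lt_succ k hk, Finset.sum_insert (by simp)]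

/-- If each layer, applied to any inputs `Z i`, has a cover of cardinality at most `exp (M l)` in
which an approximation is only demanded at the inputs of norm at most `β l`, then the first `k`
layers of the network have a cover whose logarithmic cardinality is the sum of the `M l`. -/
theorem exists_layerwise_cover {L n : ℕ} {V : Fin (L + 1) → Type*} [∀ l, AddCommGroup (V l)]
    [∀ l, Module ℝ (V l)] {normI normL : ∀ l, Seminorm ℝ (V l)} {B : Fin L → Type*}
    {S : ∀ l, Set (B l)} {F : ∀ l : Fin L, V l.castSucc → B l → V l.succ}
    {M η β : Fin L → ℝ} (A₀ : ∀ l, B l) (hA₀ : ∀ l, A₀ l ∈ S l)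
    (hcover : ∀ (l : Fin L) (Z : Fin n → V l.castSucc), ∃ 𝒟 : Finset (B l), (𝒟 : Set (B l)) ⊆ S l ∧
      (𝒟.card : ℝ) ≤ Real.exp (M l) ∧ ∀ A ∈ S l, ∃ A' ∈ 𝒟, ∀ i,
        normL l.castSucc (Z i) ≤ β l → normI l.succ (F l (Z i) A - F l (Z i) A') ≤ η l)
    (x : Fin n → V 0) (k : ℕ) (hk : k ≤ L) :
    ∃ 𝒞 : Finset (∀ l, B l), (∀ A' ∈ 𝒞, ∀ l, A' l ∈ S l) ∧
      (𝒞.card : ℝ) ≤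
        Real.exp (∑ j ∈ Finset.univ.filter (fun j : Fin L => (j : ℕ) < k), M j) ∧
      ∀ A : ∀ l, B l, (∀ l, A l ∈ S l) → ∃ A' ∈ 𝒞, ∀ (j : Fin L) (i : Fin n), (j : ℕ) < k →
        normL j.castSucc (subnet F A' (Nat.zero_le j) j.castSucc.isLt (x i)) ≤ β j →
        normI j.succ (F j (subnet F A' (Nat.zero_le j) j.castSucc.isLt (x i)) (A j) -
          F j (subnet F A' (Nat.zero_le j) j.castSucc.isLt (x i)) (A' j)) ≤ η j := by
  classical
  induction k with
  | zero => exact ⟨{A₀}, by simpa using hA₀, by simp, fun A _ => ⟨A₀, by simp, by simp⟩⟩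
  | succ k ih =>
    obtain ⟨𝒞, hS, hcard, hcov⟩ := ih (by omega)
    let κ : Fin L := ⟨k, hk⟩
    choose 𝒟 hDS hDcard hDcov using fun A' : ∀ l, B l =>
      hcover κ fun i => subnet F A' (Nat.zero_le k) κ.castSucc.isLt (x i)
    refine ⟨𝒞.biUnion fun A' => (𝒟 A').image (Function.update A' κ), ?_, ?_, ?_⟩
    · intro A' hA' l
      simp only [Finset.mem_biUnion, Finset.mem_image] at hA'
      obtain ⟨A₁, h₁, d, hd, rfl⟩ := hA'
      by_cases hl : l = κ
      · subst hl
        simpa using hDS A₁ hd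
      · simpa [hl] using hS A₁ h₁ l
    · rw [sum_filter_val_lt_succ k hk, Real.exp_add]
      calc _ ≤ ((∑ A' ∈ 𝒞, (𝒟 A').card : ℕ) : ℝ) := by
            exact_mod_cast Finset.card_biUnion_le.trans
              (Finset.sum_le_sum fun _ _ => Finset.card_image_le)
        _ ≤ ∑ A' ∈ 𝒞, Real.exp (M κ) := by
            push_cast
            exact Finset.sum_le_sum fun A' _ => hDcard A'
        _ ≤ _ := by
            rw [Finset.sum_const, nsmul_eq_mul, mul_comm]
            gcongr
    · intro A hA
      obtain ⟨A₁, h₁, hcov₁⟩ := hcov A hA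
      obtain ⟨d, hd, hdcov⟩ := hDcov A₁ (A κ) (hA κ)
      refine ⟨Function.update A₁ κ d, ?_, ?_⟩
      · simp only [Finset.mem_biUnion, Finset.mem_image]
        exact ⟨A₁, h₁, d, hd, rfl⟩
      · intro j i hj
        have hsub := subnet_congr F (A := Function.update A₁ κ d) (A' := A₁) (Nat.zero_le j)
          j.castSucc.isLt (fun l hl => Function.update_of_ne
            (fun h => by have := congrArg Fin.val h; simp only [κ] at this; omega) _ _) (x i)
        rw [hsub]
        by_cases hjk : j = κ
        · subst hjk
          rw [Function.update_self]
          exact hdcov i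
        · rw [Function.update_of_ne hjk]
          refine hcov₁ j i ?_
          have : (j : ℕ) ≠ k := fun h => hjk (Fin.ext h)
          omega

section Error

variable {L : ℕ} {V : Fin (L + 1) → Type*} [∀ l, AddCommGroup (V l)]
  [∀ l, Module ℝ (V l)] {normI normL : ∀ l, Seminorm ℝ (V l)} {B : Fin L → Type*}
  {F : ∀ l : Fin L, V l.castSucc → B l → V l.succ} {A A' : ∀ l, B l}
  {η ρ : Fin L → ℝ} {b : Fin (L + 1) → ℝ}

/-- Telescoping: replacing the first `m` layers of a network perturbs its output by at most the
sum of the perturbations of these layers, each amplified by the layers above it. -/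
theorem norm_subnet_sub_subnet_le (hρ : ∀ l, 0 ≤ ρ l) (hb : ∀ l, 0 ≤ b l)
    (hlip : ∀ (l₁ : Fin L) (l₂ : Fin (L + 1)) (h : (l₁ : ℕ) + 1 ≤ l₂),
      lipConst (normI l₁.succ) (normL l₂) (subnet F A h l₂.isLt) ≤ ENNReal.ofReal (ρ l₁ * b l₂))
    (x : V 0) (l : Fin (L + 1)) (m : ℕ) (hm : m ≤ l)
    (hη : ∀ j : Fin L, (j : ℕ) < m →
      normI j.succ (F j (subnet F A' (Nat.zero_le j) j.castSucc.isLt x) (A j) -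
        F j (subnet F A' (Nat.zero_le j) j.castSucc.isLt x) (A' j)) ≤ η j) :
    normL l (subnet F A (Nat.zero_le l) l.isLt x -
      subnet F A hm l.isLt (subnet F A' (Nat.zero_le m) (hm.trans_lt l.isLt) x)) ≤
        ∑ j ∈ Finset.univ.filter (fun j : Fin L => (j : ℕ) < m), ρ j * b l * η j := by
  induction m with
  | zero =>
    have h0 := subnet_self F A' (Nat.succ_pos L) x
    rw [h0, sub_self]
    simp
  | succ m ih =>
    have hmL : m < L := by omega
    rw [sum_filter_val_lt_succ m hmL]
    have h₁ := ih (by omega) fun j hj => hη j (by omega)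
    have h₂ := le_mul_of_lipConst_le (mul_nonneg (hρ _) (hb _)) (hlip ⟨m, hmL⟩ l hm)
      (F ⟨m, hmL⟩ (subnet F A' (Nat.zero_le m) (by omega) x) (A ⟨m, hmL⟩))
      (F ⟨m, hmL⟩ (subnet F A' (Nat.zero_le m) (by omega) x) (A' ⟨m, hmL⟩))
    have h₃ := mul_le_mul_of_nonneg_left (hη ⟨m, hmL⟩ (Nat.lt_succ_self m))
      (mul_nonneg (hρ ⟨m, hmL⟩) (hb l))
    rw [subnet_eq_subnet_layer F A hm l.isLt] at h₁
    have hsucc := subnet_succ F A' (Nat.zero_le m) hmL x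
    rw [hsucc]
    have h₄ := map_add_le_add (normL l) _ _ |>.trans (add_le_add h₁ (h₂.trans h₃))
    rw [sub_add_sub_cancel] at h₄
    linarith

theorem norm_subnet_sub_le_and_norm_subnet_le {ε : ℝ} (hε1 : ε ≤ 1) (hρ : ∀ l, 0 ≤ ρ l)
    (hb : ∀ l, 0 ≤ b l) (hη₀ : ∀ l, 0 ≤ η l) (hsum : ∑ j, ρ j * η j ≤ ε)
    (hlip : ∀ (l₁ : Fin L) (l₂ : Fin (L + 1)) (h : (l₁ : ℕ) + 1 ≤ l₂),
      lipConst (normI l₁.succ) (normL l₂) (subnet F A h l₂.isLt) ≤ ENNReal.ofReal (ρ l₁ * b l₂))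
    (x : V 0)
    (hη : ∀ j : Fin L,
      normL j.castSucc (subnet F A' (Nat.zero_le j) j.castSucc.isLt x) ≤ 2 * b j.castSucc →
      normI j.succ (F j (subnet F A' (Nat.zero_le j) j.castSucc.isLt x) (A j) -
        F j (subnet F A' (Nat.zero_le j) j.castSucc.isLt x) (A' j)) ≤ η j)
    (hx : ∀ l : Fin (L + 1), normL l (subnet F A (Nat.zero_le l) l.isLt x) ≤ b l)
    (l : Fin (L + 1)) :
    normL l (subnet F A (Nat.zero_le l) l.isLt x - subnet F A' (Nat.zero_le l) l.isLt x) ≤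
        ε * b l ∧
      normL l (subnet F A' (Nat.zero_le l) l.isLt x) ≤ 2 * b l := by
  obtain ⟨l, hl⟩ := l
  induction l using Nat.strong_induction_on with
  | _ l ih =>
    have h₁ := norm_subnet_sub_subnet_le (A' := A') hρ hb hlip x ⟨l, hl⟩ l le_rfl
      fun j hj => hη j (ih j hj j.castSucc.isLt).2
    rw [subnet_self] at h₁
    have h₂ : ∑ j ∈ Finset.univ.filter (fun j : Fin L => (j : ℕ) < l), ρ j * b ⟨l, hl⟩ * η j ≤
        ε * b ⟨l, hl⟩ :=
      calc _ ≤ ∑ j, ρ j * b ⟨l, hl⟩ * η j :=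
            Finset.sum_le_sum_of_subset_of_nonneg (Finset.filter_subset _ _) fun j _ _ =>
              mul_nonneg (mul_nonneg (hρ j) (hb _)) (hη₀ j)
        _ = (∑ j, ρ j * η j) * b ⟨l, hl⟩ := by
            rw [Finset.sum_mul]
            exact Finset.sum_congr rfl fun j _ => by ring
        _ ≤ _ := mul_le_mul_of_nonneg_right hsum (hb _)
    have h₃ := h₁.trans h₂
    refine ⟨h₃, ?_⟩
    have h₄ := map_sub_le_add (normL ⟨l, hl⟩) (subnet F A (Nat.zero_le l) hl x)
      (subnet F A (Nat.zero_le l) hl x - subnet F A' (Nat.zero_le l) hl x)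
    rw [sub_sub_cancel] at h₄
    have h₅ := hx ⟨l, hl⟩
    have h₆ := mul_le_mul_of_nonneg_right hε1 (hb ⟨l, hl⟩)
    simp only at h₃ h₄ h₅ ⊢
    linarith

end Error

section Accuracy

variable {L : ℕ} {ε : ℝ} {K a ρ : Fin L → ℝ} {b : Fin (L + 1) → ℝ}

theorem layerSize_pos (hK : ∀ l, 0 < K l) (ha : ∀ l, 0 < a l) (hρ : ∀ l, 0 < ρ l)
    (hb : ∀ l, 0 < b l) (l : Fin L) : 0 < layerSize K a ρ b l :=
  mul_pos (mul_pos (mul_pos (Real.sqrt_pos.2 (hK l)) (ha l)) (hb _)) (hρ l)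

theorem rpow_two_thirds_pow_three {r : ℝ} (hr : 0 ≤ r) : (r ^ ((2 : ℝ) / 3)) ^ 3 = r ^ 2 := by
  rw [← Real.rpow_natCast, ← Real.rpow_mul hr, ← Real.rpow_natCast r 2]
  norm_num

theorem sum_layerSize_rpow_pos (hr : ∀ l, 0 < layerSize K a ρ b l) (l : Fin L) :
    0 < ∑ j, layerSize K a ρ b j ^ ((2 : ℝ) / 3) :=
  Finset.sum_pos (fun j _ => Real.rpow_pos_of_pos (hr j) _) ⟨l, Finset.mem_univ l⟩

theorem layerAccuracy_pos (hε : 0 < ε) (hρ : ∀ l, 0 < ρ l) (hr : ∀ l, 0 < layerSize K a ρ b l)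
    (l : Fin L) : 0 < layerAccuracy ε K a ρ b l :=
  div_pos (mul_pos (div_pos (Real.rpow_pos_of_pos (hr l) _) (sum_layerSize_rpow_pos hr l)) hε)
    (hρ l)

theorem sum_mul_layerAccuracy_le (hε : 0 ≤ ε) (hρ : ∀ l, 0 < ρ l) :
    ∑ l, ρ l * layerAccuracy ε K a ρ b l ≤ ε := by
  have h : ∀ l, ρ l * layerAccuracy ε K a ρ b l =
      layerSize K a ρ b l ^ ((2 : ℝ) / 3) / (∑ j, layerSize K a ρ b j ^ ((2 : ℝ) / 3)) * ε :=
    fun l => mul_div_cancel₀ _ (hρ l).ne'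
  simp_rw [h]
  rw [← Finset.sum_mul, ← Finset.sum_div]
  exact mul_le_of_le_one_left hε (div_self_le_one _)

/-- The layer accuracies are chosen such that the entropies of the layers add up to a cube. -/
theorem sum_entropy_layerAccuracy (hε : 0 < ε) (hK : ∀ l, 0 < K l) (hρ : ∀ l, 0 < ρ l)
    (hr : ∀ l, 0 < layerSize K a ρ b l) :
    ∑ l, K l * a l ^ 2 * (2 * b l.castSucc) ^ 2 / layerAccuracy ε K a ρ b l ^ 2 =
      4 * (∑ l, (layerSize K a ρ b l / ε) ^ ((2 : ℝ) / 3)) ^ 3 := by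
  have hdiv : ∀ l, (layerSize K a ρ b l / ε) ^ ((2 : ℝ) / 3) =
      layerSize K a ρ b l ^ ((2 : ℝ) / 3) / ε ^ ((2 : ℝ) / 3) :=
    fun l => Real.div_rpow (hr l).le hε.le _
  simp_rw [hdiv]
  rw [← Finset.sum_div, div_pow, rpow_two_thirds_pow_three hε.le]
  set s := fun l => layerSize K a ρ b l ^ ((2 : ℝ) / 3) with hs
  set T := ∑ l, s l with hT
  have hterm : ∀ l, K l * a l ^ 2 * (2 * b l.castSucc) ^ 2 / layerAccuracy ε K a ρ b l ^ 2 =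
      4 * T ^ 2 / ε ^ 2 * s l := by
    intro l
    have hsl : 0 < s l := Real.rpow_pos_of_pos (hr l) _
    have hTl : 0 < T := sum_layerSize_rpow_pos hr l
    have hcube : s l ^ 3 = K l * a l ^ 2 * b l.castSucc ^ 2 * ρ l ^ 2 := by
      rw [hs]
      simp only
      rw [rpow_two_thirds_pow_three (hr l).le, layerSize, mul_pow, mul_pow, mul_pow,
        Real.sq_sqrt (hK l).le]
    have hacc : layerAccuracy ε K a ρ b l = s l / T * ε / ρ l := rfl
    have hρl := (hρ l).ne'
    rw [hacc]
    field_simp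
    linear_combination (-4) * hcube
  simp_rw [hterm]
  rw [← Finset.mul_sum, ← hT]
  ring

theorem four_mul_sum_rpow_pow_three_le {r : Fin L → ℝ} (hr : ∀ l, 0 ≤ r l) (hε : 0 < ε)
    (hε1 : ε ≤ 1) :
    4 * (∑ l, r l ^ ((2 : ℝ) / 3)) ^ 3 ≤ 4 * ((L : ℝ) ^ 2 / ε ^ 2) * ∑ l, r l ^ 2 := by
  have h₁ : (∑ l, r l ^ ((2 : ℝ) / 3)) ^ 3 ≤ (L : ℝ) ^ 2 * ∑ l, r l ^ 2 := by
    rcases Nat.eq_zero_or_pos L with rfl | hL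
    · simp
    have h := pow_sum_div_card_le_sum_pow (s := Finset.univ) (f := fun l => r l ^ ((2 : ℝ) / 3))
      (fun l _ => Real.rpow_nonneg (hr l) _) 2
    simp only [Nat.reduceAdd, Finset.card_univ, Fintype.card_fin,
      rpow_two_thirds_pow_three (hr _)] at h
    rwa [div_le_iff₀' (by positivity)] at h
  have h₂ : (L : ℝ) ^ 2 ≤ (L : ℝ) ^ 2 / ε ^ 2 :=
    le_div_self (sq_nonneg _) (pow_pos hε 2) (pow_le_one₀ hε.le hε1)
  have h₃ : 0 ≤ ∑ l, r l ^ 2 := Finset.sum_nonneg fun l _ => sq_nonneg _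
  nlinarith [mul_le_mul_of_nonneg_right h₂ h₃]

end Accuracy

theorem chaining_cover_with_norm_control
    (L n : ℕ)
    (V : Fin (L + 1) → Type*) [∀ l, AddCommGroup (V l)] [∀ l, Module ℝ (V l)]
    -- the two norms `|·|_{∞,l}` and `|·|_l` on `V l`
    (normI normL : ∀ l, Seminorm ℝ (V l))
    (hnormI : ∀ l x, normI l x = 0 → x = 0) (hnormL : ∀ l x, normL l x = 0 → x = 0)
    (B : Fin L → Type*) [∀ l, NormedAddCommGroup (B l)] [∀ l, NormedSpace ℝ (B l)]
    (a : Fin L → ℝ) (ha : ∀ l, 0 < a l)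
    (F : ∀ l : Fin L, V l.castSucc → B l → V l.succ)
    (C : Fin L → ℝ → ℕ → ℝ)
    (hcover : ∀ (l : Fin L) (β : ℝ), 0 < β → ∀ Z : Fin n → V l.castSucc,
      (∀ i, normL l.castSucc (Z i) ≤ β) → ∀ η : ℝ, 0 < η →
      ∃ 𝒟 : Finset (B l), (𝒟 : Set (B l)) ⊆ Metric.closedBall 0 (a l) ∧
        Real.log (𝒟.card : ℝ) ≤ C l η n * a l ^ 2 * β ^ 2 / η ^ 2 ∧
        ∀ A ∈ Metric.closedBall (0 : B l) (a l), ∃ A' ∈ 𝒟,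
          ∀ i, normI l.succ (F l (Z i) A - F l (Z i) A') ≤ η)
    (ε : ℝ) (hε : 0 < ε) (hε1 : ε < 1)
    (b : Fin (L + 1) → ℝ) (hb : ∀ l, 1 ≤ b l) (hbL : b (Fin.last L) = 1)
    (ρ : Fin L → ℝ) (hρ : ∀ l, 0 < ρ l)
    (x : Fin n → V 0) (hx : ∀ i, normL 0 (x i) ≤ b 0)
    -- `K l` bounds the constant of layer `l` at the accuracy used at layer `l`
    (K : Fin L → ℝ) (hK : ∀ l, 0 < K l) (hCK : ∀ l, C l (layerAccuracy ε K a ρ b l) n ≤ K l) :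
    ∃ 𝒞 : Finset (∀ l, B l),
      (∀ A' ∈ 𝒞, ∀ l, A' l ∈ Metric.closedBall (0 : B l) (a l)) ∧
      (∀ A : ∀ l, B l, (∀ l, A l ∈ Metric.closedBall (0 : B l) (a l)) →
        (∀ (l₁ : Fin L) (l₂ : Fin (L + 1)) (h : (l₁ : ℕ) + 1 ≤ l₂),
          lipConst (normI l₁.succ) (normL l₂) (subnet F A h l₂.isLt) ≤
            ENNReal.ofReal (ρ l₁ * b l₂)) →
        ∃ A' ∈ 𝒞, ∀ i : Fin n,
          (∀ l : Fin (L + 1), normL l (subnet F A (Nat.zero_le l) l.isLt (x i)) ≤ b l) →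
          ∀ l : Fin (L + 1),
            normL l (subnet F A (Nat.zero_le l) l.isLt (x i) -
              subnet F A' (Nat.zero_le l) l.isLt (x i)) ≤ ε * b l ∧
            normL l (subnet F A' (Nat.zero_le l) l.isLt (x i)) ≤ 2 * b l) ∧
      Real.log (𝒞.card : ℝ) ≤
        4 * (∑ l : Fin L, (Real.sqrt (K l) * a l * b l.castSucc * ρ l / ε) ^ ((2 : ℝ) / 3)) ^ 3 ∧
      4 * (∑ l : Fin L, (Real.sqrt (K l) * a l * b l.castSucc * ρ l / ε) ^ ((2 : ℝ) / 3)) ^ 3 ≤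
        4 * ((L : ℝ) ^ 2 / ε ^ 2) *
          ∑ l : Fin L, (Real.sqrt (K l) * a l * b l.castSucc * ρ l / ε) ^ 2 := by
  have hb₀ : ∀ l, 0 < b l := fun l => one_pos.trans_le (hb l)
  have hr := layerSize_pos hK ha hρ hb₀
  have hη := layerAccuracy_pos hε hρ hr
  have hlayer : ∀ (l : Fin L) (Z : Fin n → V l.castSucc), ∃ 𝒟 : Finset (B l),
      (𝒟 : Set (B l)) ⊆ Metric.closedBall 0 (a l) ∧
      (𝒟.card : ℝ) ≤ Real.exp
        (K l * a l ^ 2 * (2 * b l.castSucc) ^ 2 / layerAccuracy ε K a ρ b l ^ 2) ∧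
      ∀ A ∈ Metric.closedBall (0 : B l) (a l), ∃ A' ∈ 𝒟, ∀ i,
        normL l.castSucc (Z i) ≤ 2 * b l.castSucc →
          normI l.succ (F l (Z i) A - F l (Z i) A') ≤ layerAccuracy ε K a ρ b l := by
    classical
    intro l Z
    have hβ : 0 < 2 * b l.castSucc := mul_pos two_pos (hb₀ _)
    obtain ⟨𝒟, hsub, hlog, hcov⟩ := hcover l (2 * b l.castSucc) hβ
      (fun i => if normL l.castSucc (Z i) ≤ 2 * b l.castSucc then Z i else 0)
      (fun i => by
        split_ifs with h
        · exact h
        · simpa using hβ.le) _ (hη l)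
    refine ⟨𝒟, hsub, (Real.le_exp_log _).trans (Real.exp_le_exp.2 (hlog.trans ?_)), ?_⟩
    · have := hCK l
      gcongr
    · intro A hA
      obtain ⟨A', hA', h⟩ := hcov A hA
      refine ⟨A', hA', fun i hi => ?_⟩
      simpa only [if_pos hi] using h i
  obtain ⟨𝒞, hball, hcard, hcov⟩ := exists_layerwise_cover (F := F) (fun _ => 0)
    (fun l => Metric.mem_closedBall_self (ha l).le) hlayer x L le_rfl
  refine ⟨𝒞, hball, ?_, ?_, four_mul_sum_rpow_pow_three_le
    (fun l => div_nonneg (hr l).le hε.le) hε hε1.le⟩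
  · intro A hA hlip
    obtain ⟨A', hA', h⟩ := hcov A hA
    exact ⟨A', hA', fun i hi => norm_subnet_sub_le_and_norm_subnet_le hε1.le (fun l => (hρ l).le)
      (fun l => (hb₀ l).le) (fun l => (hη l).le) (sum_mul_layerAccuracy_le hε.le hρ) hlip (x i)
      (fun j => h j i j.isLt) hi⟩
  · obtain ⟨A', hA', -⟩ := hcov (fun _ => 0) fun l => Metric.mem_closedBall_self (ha l).le
    rw [Real.log_le_iff_le_exp (Nat.cast_pos.2 (Finset.card_pos.2 ⟨A', hA'⟩))]
    refine hcard.trans (Real.exp_le_exp.2 ?_)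
    rw [Finset.filter_true_of_mem fun j _ => j.isLt, sum_entropy_layerAccuracy hε hK hρ hr]
    rfl
end

section
/- Let $L\in\mathbb N$, let $a_1,\dots,a_L>0$ and $\rho_1,\dots,\rho_L>0$ be real numbers, let $V_0,\dots,V_L$ be real vector spaces with norms $|\cdot|_0,\dots,|\cdot|_L$, let $B_1,\dots,B_L$ be real normed vector spaces, and let $\mathcal B_l$ be the closed ball of radius $a_l$ about $0$ in $B_l$. For $1\le l\le L$ let $F^l:V_{l-1}\times B_l\to V_l$, $(x,A)\mapsto F^l_A(x)$, be a map with $F^l_A(0)=0$ for all $A\in\mathcal B_l$. Assume: (1) for all $l$ and all $A\in\mathcal B_l$, the map $F^l_A$ is $\rho_l$-Lipschitz with respect to $|\cdot|_{l-1}$ and $|\cdot|_l$; (2) there are real numbers $C_{l,\delta}$ ($1\le l\le L$, $\delta>0$) such that for all $l$, all $b>0$ and all $\delta>0$ there is a finite set $\mathcal C_l(b,\delta)\subseteq\mathcal B_l$ with $\log\#\mathcal C_l(b,\delta)\le C_{l,\delta}\,a_l^2b^2/\delta^2$ such that for all $A\in\mathcal B_l$ and all $x\in V_{l-1}$ with $|x|_{l-1}\le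 b$ there is $\bar A\in\mathcal C_l(b,\delta)$ with $|F^l_A(x)-F^l_{\bar A}(x)|_l\le\delta$. Write $\mathcal B=\mathcal B_1\times\cdots\times\mathcal B_L$ and, for $\mathcal A=(A^1,\dots,A^L)\in\mathcal B$ and $0\le l\le L$, write $F^{0\to l}_{\mathcal A}=F^l_{A^l}\circ\cdots\circ F^1_{A^1}$ and $F_{\mathcal A}=F^{0\to L}_{\mathcal A}$. For a subset $S$ of $V_L$ let $\mathcal N(S,\varepsilon,|\cdot|_L)$ be the minimum number of points of $V_L$ such that every element of $S$ is within distance $\varepsilon$ of one of them. For $X\in V_0$, $\varepsilon>0$ and $c=(c_1,\dots,c_L)\in[0,\infty)^L$ put $$M(X,\varepsilon,c)=\frac{|X|_0^2\prod_{i=1}^L\rho_i^2}{\varepsilon^2}\Big[\sum_{l=1}^L\Big(\frac{c_l^{1/2}a_l}{\rho_l}\Big)^{2/3}\Big]^3 ,$$ and say that the chaining bound holds with constants $c$ if * there is a finite set $\mathcal C\subseteq\mathcal B$ with $\log\#\mathcal C\le M(X,\varepsilon,c)$ such that for every $\mathcal A\in\mathcal B$ there is $\bar{\mathcal A}\in\mathcal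 C$ with $|F^{0\to l}_{\mathcal A}(X)-F^{0\to l}_{\bar{\mathcal A}}(X)|_l\le\varepsilon/\prod_{j=l+1}^L\rho_j$ for all $0\le l\le L$; * $\mathcal N(\{F_{\mathcal A}(X):\mathcal A\in\mathcal B\},\varepsilon,|\cdot|_L)$ is finite and $\log\mathcal N(\{F_{\mathcal A}(X):\mathcal A\in\mathcal B\},\varepsilon,|\cdot|_L)\le M(X,\varepsilon,c)$; * $M(X,\varepsilon,c)\le L^2\,\frac{|X|_0^2\prod_{i=1}^L\rho_i^2}{\varepsilon^2}\sum_{l=1}^L\big(c_l^{1/2}a_l/\rho_l\big)^2$. Then for every $X\in V_0$ and every $\varepsilon>0$: (i) The chaining bound holds with constants $c$ whenever $c_1,\dots,c_L>0$ satisfy $C_{l,\varepsilon_l}\le c_l$ for all $l$, where $$\varepsilon_l=\frac{\varepsilon\,\alpha_l}{\prod_{j=l+1}^L\rho_j},\qquad \alpha_l=\frac{(c_l^{1/2}a_l/\rho_l)^{2/3}}{\sum_{i=1}^L(c_i^{1/2}a_i/\rho_i)^{2/3}} .$$ (ii) If in addition every $F^l_A$ with $A\in\mathcal B_l$ is positively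 homogeneous, that is, $F^l_A(tx)=tF^l_A(x)$ for all $t>0$ and $x\in V_{l-1}$, then the chaining bound holds with the constants $c_l=C_{l,\varepsilon}$; in particular $$\log\mathcal N(\{F_{\mathcal A}(X):\mathcal A\in\mathcal B\},\varepsilon,|\cdot|_L)\le\frac{|X|_0^2\prod_{i=1}^L\rho_i^2}{\varepsilon^2}\Big[\sum_{l=1}^L\Big(\frac{C_{l,\varepsilon}^{1/2}a_l}{\rho_l}\Big)^{2/3}\Big]^3 .$$ -/
/-- All partial compositions of a chain of `L` parametrised layers: `chainNet F A x l` is the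
activation `F^l_{A^l} ∘ ⋯ ∘ F^1_{A^1} (x)` after the first `l` layers, for `0 ≤ l ≤ L`.
The layers are numbered from `0`: `F l`, `l : Fin L`, maps `V l` to `V (l + 1)`. -/
def chainNet {L : ℕ} {V : Fin (L + 1) → Type*} {B : Fin L → Type*}
    (F : ∀ l : Fin L, V l.castSucc → B l → V l.succ) (A : ∀ l, B l) (x : V 0)
    (l : Fin (L + 1)) : V l :=
  Fin.induction (motive := V) x (fun k y => F k y (A k)) l

/-- The product `𝓑₁ × ⋯ × 𝓑_L` of the closed balls of radii `a l` about `0`. -/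
def paramSet {L : ℕ} {B : Fin L → Type*} [∀ l, NormedAddCommGroup (B l)] (a : Fin L → ℝ) :
    Set (∀ l, B l) :=
  {A | ∀ l, ‖A l‖ ≤ a l}

/-- The weight `(c_l^{1/2} a_l / ρ_l)^{2/3}` of layer `l`. -/
noncomputable def layerWeight {L : ℕ} (a ρ c : Fin L → ℝ) (l : Fin L) : ℝ :=
  (Real.sqrt (c l) * a l / ρ l) ^ ((2 : ℝ) / 3)

/-- The granularity `ε_l = ε α_l / ∏_{j > l} ρ_j` of layer `l` for the target granularity `ε`,
where `α_l` is the weight of layer `l` divided by the sum of the weights of all layers. -/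
noncomputable def layerScale {L : ℕ} (a ρ c : Fin L → ℝ) (ε : ℝ) (l : Fin L) : ℝ :=
  ε * (layerWeight a ρ c l / ∑ i, layerWeight a ρ c i) / ∏ j with l < j, ρ j

/-- The conclusion for the input `X`, the granularity `ε` and layer constants `c l`:
there is a finite set of parameters inside the product of balls, whose cardinality obeys the
bound and which approximates every parameter at every layer; the covering number of the set of
outputs (centres anywhere in the last space, closed balls) is finite and obeys the same bound;
and that bound is at most its sum-of-squares form. -/
def ChainingBound {L : ℕ} {V : Fin (L + 1) → Type*} [∀ l, NormedAddCommGroup (V l)]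
    {B : Fin L → Type*} [∀ l, NormedAddCommGroup (B l)]
    (F : ∀ l : Fin L, V l.castSucc → B l → V l.succ) (a ρ : Fin L → ℝ)
    (X : V 0) (ε : ℝ) (c : Fin L → ℝ) : Prop :=
  (∃ 𝒞 : Finset (∀ l, B l), (𝒞 : Set (∀ l, B l)) ⊆ paramSet a ∧
    (∀ A ∈ paramSet (B := B) a, ∃ A' ∈ 𝒞, ∀ l : Fin (L + 1),
      ‖chainNet F A X l - chainNet F A' X l‖ ≤ ε / ∏ j with l ≤ Fin.castSucc j, ρ j) ∧
    Real.log (𝒞.card : ℝ) ≤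
      ‖X‖ ^ 2 * (∏ i, ρ i ^ 2) / ε ^ 2 * (∑ l, layerWeight a ρ c l) ^ 3) ∧
  (∃ N : ℕ,
    Metric.externalCoveringNumber ε.toNNReal
      ((fun A => chainNet F A X (Fin.last L)) '' paramSet a) = N ∧
    Real.log (N : ℝ) ≤
      ‖X‖ ^ 2 * (∏ i, ρ i ^ 2) / ε ^ 2 * (∑ l, layerWeight a ρ c l) ^ 3) ∧
  ‖X‖ ^ 2 * (∏ i, ρ i ^ 2) / ε ^ 2 * (∑ l, layerWeight a ρ c l) ^ 3 ≤
    (L : ℝ) ^ 2 * (‖X‖ ^ 2 * (∏ i, ρ i ^ 2) / ε ^ 2) *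
      ∑ l, (Real.sqrt (c l) * a l / ρ l) ^ 2

open Finset in
/-- Summing over the layers before `l + 1` adds the layer `l`. -/
theorem Fin.sum_castSucc_lt_succ {L : ℕ} (f : Fin L → ℝ) (l : Fin L) :
    ∑ j with Fin.castSucc j < l.succ, f j = (∑ j with Fin.castSucc j < l.castSucc, f j) + f l := by
  have : ({j | Fin.castSucc j < l.succ} : Finset (Fin L)) =
      insert l ({j | Fin.castSucc j < l.castSucc} : Finset (Fin L)) := by
    ext j
    simp [Fin.castSucc_lt_succ_iff, le_iff_eq_or_lt]
  rw [this, sum_insert (by simp), add_comm]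

open Finset in
theorem Fin.prod_castSucc_lt_succ {L : ℕ} (f : Fin L → ℝ) (l : Fin L) :
    ∏ j with Fin.castSucc j < l.succ, f j = (∏ j with Fin.castSucc j < l.castSucc, f j) * f l := by
  have : ({j | Fin.castSucc j < l.succ} : Finset (Fin L)) =
      insert l ({j | Fin.castSucc j < l.castSucc} : Finset (Fin L)) := by
    ext j
    simp [Fin.castSucc_lt_succ_iff, le_iff_eq_or_lt]
  rw [this, prod_insert (by simp), mul_comm]

theorem Fin.prod_succ_le_castSucc {L : ℕ} (f : Fin L → ℝ) (l : Fin L) :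
    ∏ j with l.succ ≤ Fin.castSucc j, f j = ∏ j with l < j, f j := by
  simp [Fin.succ_le_castSucc_iff]

open Finset in
theorem Fin.prod_castSucc_le_castSucc {L : ℕ} (f : Fin L → ℝ) (l : Fin L) :
    ∏ j with l.castSucc ≤ Fin.castSucc j, f j = f l * ∏ j with l < j, f j := by
  have : ({j | l.castSucc ≤ Fin.castSucc j} : Finset (Fin L)) =
      insert l ({j | l < j} : Finset (Fin L)) := by
    ext j
    simp [le_iff_eq_or_lt, eq_comm]
  rw [this, prod_insert (by simp)]

open Finset in
/-- Splitting the product of all layers at the layer `l`. -/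
theorem Fin.prod_lt_mul_prod_gt {L : ℕ} (f : Fin L → ℝ) (l : Fin L) :
    (∏ j with Fin.castSucc j < l.castSucc, f j) * (f l * ∏ j with l < j, f j) = ∏ j, f j := by
  rw [← Fin.prod_castSucc_le_castSucc,
    ← prod_filter_mul_prod_filter_not univ (fun j : Fin L => Fin.castSucc j < l.castSucc)]
  simp only [not_lt]

theorem chainNet_zero {L : ℕ} {V : Fin (L + 1) → Type*} {B : Fin L → Type*}
    (F : ∀ l : Fin L, V l.castSucc → B l → V l.succ) (A : ∀ l, B l) (x : V 0) :
    chainNet F A x 0 = x := rfl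

theorem chainNet_succ {L : ℕ} {V : Fin (L + 1) → Type*} {B : Fin L → Type*}
    (F : ∀ l : Fin L, V l.castSucc → B l → V l.succ) (A : ∀ l, B l) (x : V 0) (l : Fin L) :
    chainNet F A x l.succ = F l (chainNet F A x l.castSucc) (A l) := rfl

/-- A parameter chosen layer by layer, each choice depending on the activation reached so far. -/
theorem exists_chainNet_choice {L : ℕ} {V : Fin (L + 1) → Type*} {B : Fin L → Type*}
    (F : ∀ l : Fin L, V l.castSucc → B l → V l.succ) (g : ∀ l : Fin L, V l.castSucc → B l)
    (x : V 0) :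
    ∃ A : ∀ l, B l, ∀ l, A l = g l (chainNet F A x l.castSucc) := by
  let y : ∀ l, V l := fun l => Fin.induction (motive := V) x (fun k z => F k z (g k z)) l
  have hy : ∀ l, chainNet F (fun l => g l (y l.castSucc)) x l = y l := by
    intro l
    induction l using Fin.induction with
    | zero => rfl
    | succ k ih => rw [chainNet_succ, ih]; rfl
  exact ⟨fun l => g l (y l.castSucc), fun l => by rw [hy]⟩

section

variable {L : ℕ} {V : Fin (L + 1) → Type*} [∀ l, NormedAddCommGroup (V l)]
  {B : Fin L → Type*} [∀ l, NormedAddCommGroup (B l)]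
  {F : ∀ l : Fin L, V l.castSucc → B l → V l.succ} {a ρ : Fin L → ℝ}

theorem norm_chainNet_le (hρ : ∀ l, 0 < ρ l)
    (hzero : ∀ l, ∀ A : B l, ‖A‖ ≤ a l → F l 0 A = 0)
    (hLip : ∀ l, ∀ A : B l, ‖A‖ ≤ a l → ∀ x y : V l.castSucc,
      ‖F l x A - F l y A‖ ≤ ρ l * ‖x - y‖)
    {A : ∀ l, B l} (hA : A ∈ paramSet a) (X : V 0) (l : Fin (L + 1)) :
    ‖chainNet F A X l‖ ≤ ‖X‖ * ∏ j with Fin.castSucc j < l, ρ j := by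
  induction l using Fin.induction with
  | zero => simp [chainNet_zero]
  | succ k ih =>
    have h := hLip k (A k) (hA k) (chainNet F A X k.castSucc) 0
    rw [hzero k _ (hA k), sub_zero, sub_zero] at h
    rw [chainNet_succ, Fin.prod_castSucc_lt_succ]
    calc _ ≤ ρ k * ‖chainNet F A X k.castSucc‖ := h
      _ ≤ ρ k * (‖X‖ * ∏ j with Fin.castSucc j < k.castSucc, ρ j) :=
        mul_le_mul_of_nonneg_left ih (hρ k).le
      _ = _ := by ring

/-- Layerwise errors `ε * α l / ∏ j > l, ρ j` along the approximating chain add up. -/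
theorem norm_chainNet_sub_le (hρ : ∀ l, 0 < ρ l)
    (hLip : ∀ l, ∀ A : B l, ‖A‖ ≤ a l → ∀ x y : V l.castSucc,
      ‖F l x A - F l y A‖ ≤ ρ l * ‖x - y‖)
    {A A' : ∀ l, B l} (hA : A ∈ paramSet a) (X : V 0) {ε : ℝ} {α : Fin L → ℝ}
    (h : ∀ l, ‖F l (chainNet F A' X l.castSucc) (A l) -
      F l (chainNet F A' X l.castSucc) (A' l)‖ ≤ ε * α l / ∏ j with l < j, ρ j)
    (l : Fin (L + 1)) :
    ‖chainNet F A X l - chainNet F A' X l‖ ≤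
      ε * (∑ j with Fin.castSucc j < l, α j) / ∏ j with l ≤ Fin.castSucc j, ρ j := by
  induction l using Fin.induction with
  | zero => simp [chainNet_zero]
  | succ k ih =>
    rw [Fin.sum_castSucc_lt_succ, Fin.prod_succ_le_castSucc]
    rw [Fin.prod_castSucc_le_castSucc] at ih
    have hP : 0 < ∏ j with k < j, ρ j := Finset.prod_pos fun j _ => hρ j
    have hk := hρ k
    rw [chainNet_succ, chainNet_succ]
    calc _ ≤ ‖F k (chainNet F A X k.castSucc) (A k) - F k (chainNet F A' X k.castSucc) (A k)‖
          + ‖F k (chainNet F A' X k.castSucc) (A k) - F k (chainNet F A' X k.castSucc) (A' k)‖ :=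
          norm_sub_le_norm_sub_add_norm_sub _ _ _
      _ ≤ ρ k * ‖chainNet F A X k.castSucc - chainNet F A' X k.castSucc‖ +
          ε * α k / ∏ j with k < j, ρ j := add_le_add (hLip k _ (hA k) _ _) (h k)
      _ ≤ ρ k * (ε * (∑ j with Fin.castSucc j < k.castSucc, α j) /
            (ρ k * ∏ j with k < j, ρ j)) + ε * α k / ∏ j with k < j, ρ j := by
          gcongr
      _ = _ := by field_simp

theorem layerWeight_nonneg (ha : ∀ l, 0 < a l) (hρ : ∀ l, 0 < ρ l) (c : Fin L → ℝ) (l : Fin L) :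
    0 ≤ layerWeight a ρ c l :=
  Real.rpow_nonneg (div_nonneg (mul_nonneg (Real.sqrt_nonneg _) (ha l).le) (hρ l).le) _

theorem layerWeight_pos (ha : ∀ l, 0 < a l) (hρ : ∀ l, 0 < ρ l) {c : Fin L → ℝ} {l : Fin L}
    (hc : 0 < c l) : 0 < layerWeight a ρ c l :=
  Real.rpow_pos_of_pos (div_pos (mul_pos (Real.sqrt_pos.2 hc) (ha l)) (hρ l)) _

theorem layerWeight_pow_three (ha : ∀ l, 0 < a l) (hρ : ∀ l, 0 < ρ l) (c : Fin L → ℝ)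
    (l : Fin L) : layerWeight a ρ c l ^ 3 = (Real.sqrt (c l) * a l / ρ l) ^ 2 := by
  have h : 0 ≤ Real.sqrt (c l) * a l / ρ l :=
    div_nonneg (mul_nonneg (Real.sqrt_nonneg _) (ha l).le) (hρ l).le
  rw [layerWeight, ← Real.rpow_natCast, ← Real.rpow_mul h, ← Real.rpow_natCast]
  norm_num

theorem layerScale_pos (ha : ∀ l, 0 < a l) (hρ : ∀ l, 0 < ρ l) {c : Fin L → ℝ} {ε : ℝ}
    (hε : 0 < ε) {l : Fin L} (hc : 0 < c l) : 0 < layerScale a ρ c ε l := by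
  have hw := layerWeight_pos ha hρ hc
  have hW : 0 < ∑ i, layerWeight a ρ c i :=
    hw.trans_le (Finset.single_le_sum (fun i _ => layerWeight_nonneg ha hρ c i)
      (Finset.mem_univ l))
  exact div_pos (mul_pos hε (div_pos hw hW)) (Finset.prod_pos fun j _ => hρ j)

/-- The entropy of layer `l` at its scale is its share of the total entropy. -/
theorem entropy_layerScale (ha : ∀ l, 0 < a l) (hρ : ∀ l, 0 < ρ l) {c : Fin L → ℝ} {ε : ℝ}
    (hε : 0 < ε) {l : Fin L} (hc : 0 < c l) (r : ℝ) :
    c l * a l ^ 2 * (r * ∏ j with Fin.castSucc j < l.castSucc, ρ j) ^ 2 /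
        layerScale a ρ c ε l ^ 2 =
      r ^ 2 * (∏ i, ρ i ^ 2) / ε ^ 2 *
        (layerWeight a ρ c l * (∑ i, layerWeight a ρ c i) ^ 2) := by
  have hw := layerWeight_pos ha hρ hc
  have hW : 0 < ∑ i, layerWeight a ρ c i :=
    hw.trans_le (Finset.single_le_sum (fun i _ => layerWeight_nonneg ha hρ c i)
      (Finset.mem_univ l))
  have h3 := layerWeight_pow_three ha hρ c l
  have hQ : 0 < ∏ j with l < j, ρ j := Finset.prod_pos fun j _ => hρ j
  have hl := hρ l
  rw [div_pow, mul_pow, Real.sq_sqrt hc.le] at h3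
  rw [Finset.prod_pow, ← Fin.prod_lt_mul_prod_gt ρ l, layerScale]
  have h4 : c l * a l ^ 2 = layerWeight a ρ c l ^ 3 * ρ l ^ 2 := by
    rw [h3]; field_simp
  rw [h4]
  generalize layerWeight a ρ c l = w at *
  generalize ∑ i, layerWeight a ρ c i = W at *
  field_simp

theorem externalCoveringNumber_image_le {P E : Type*} [SeminormedAddCommGroup E]
    {f : P → E} {S : Set P} {𝒞 : Finset P} {ε : ℝ}
    (h : ∀ A ∈ S, ∃ A' ∈ 𝒞, ‖f A - f A'‖ ≤ ε) :
    Metric.externalCoveringNumber ε.toNNReal (f '' S) ≤ (𝒞.card : ℕ∞) := by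
  classical
  have hcov : Metric.IsCover ε.toNNReal (f '' S) ((𝒞.image f : Finset E) : Set E) := by
    rintro _ ⟨A, hA, rfl⟩
    obtain ⟨A', hA', hle⟩ := h A hA
    refine ⟨f A', by simpa using ⟨A', hA', rfl⟩, ?_⟩
    have : edist (f A) (f A') ≤ ENNReal.ofReal ε := by
      rw [edist_dist, dist_eq_norm]
      exact ENNReal.ofReal_le_ofReal hle
    exact this
  refine hcov.externalCoveringNumber_le_encard.trans ?_
  rw [Set.encard_coe_eq_coe_finsetCard]
  exact_mod_cast Finset.card_image_le

/-- Covers of the layers at the scales `layerScale` combine into the chaining bound. -/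
theorem chainingBound_of_layer_covers (ha : ∀ l, 0 < a l) (hρ : ∀ l, 0 < ρ l)
    (hzero : ∀ l, ∀ A : B l, ‖A‖ ≤ a l → F l 0 A = 0)
    (hLip : ∀ l, ∀ A : B l, ‖A‖ ≤ a l → ∀ x y : V l.castSucc,
      ‖F l x A - F l y A‖ ≤ ρ l * ‖x - y‖)
    (X : V 0) {ε : ℝ} (hε : 0 < ε) (c : Fin L → ℝ)
    (hcov : ∀ l, ∃ 𝒞 : Finset (B l), (∀ A ∈ 𝒞, ‖A‖ ≤ a l) ∧
      Real.log (𝒞.card : ℝ) ≤ ‖X‖ ^ 2 * (∏ i, ρ i ^ 2) / ε ^ 2 *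
        (layerWeight a ρ c l * (∑ i, layerWeight a ρ c i) ^ 2) ∧
      ∀ A : B l, ‖A‖ ≤ a l → ∀ x : V l.castSucc,
        ‖x‖ ≤ ‖X‖ * (∏ j with Fin.castSucc j < l.castSucc, ρ j) →
        ∃ A' ∈ 𝒞, ‖F l x A - F l x A'‖ ≤ layerScale a ρ c ε l) :
    ChainingBound F a ρ X ε c := by
  classical
  choose 𝒞 hball hcard happrox using hcov
  have hw := layerWeight_nonneg ha hρ c
  have hW : 0 ≤ ∑ i, layerWeight a ρ c i := Finset.sum_nonneg fun i _ => hw i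
  have hne : ∀ l, (𝒞 l).Nonempty := fun l => by
    obtain ⟨A', hA', -⟩ := happrox l 0 (by simpa using (ha l).le) 0
      (by simpa using mul_nonneg (norm_nonneg X) (Finset.prod_nonneg fun j _ => (hρ j).le))
    exact ⟨A', hA'⟩
  have hlog : Real.log ((Fintype.piFinset 𝒞).card : ℝ) ≤
      ‖X‖ ^ 2 * (∏ i, ρ i ^ 2) / ε ^ 2 * (∑ l, layerWeight a ρ c l) ^ 3 := by
    rw [Fintype.card_piFinset, Nat.cast_prod, Real.log_prod
      (fun l _ => Nat.cast_ne_zero.2 (hne l).card_pos.ne')]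
    refine (Finset.sum_le_sum fun l _ => hcard l).trans_eq ?_
    rw [← Finset.mul_sum, ← Finset.sum_mul]
    ring
  have hmain : ∀ A ∈ paramSet (B := B) a, ∃ A' ∈ Fintype.piFinset 𝒞, ∀ l : Fin (L + 1),
      ‖chainNet F A X l - chainNet F A' X l‖ ≤ ε / ∏ j with l ≤ Fin.castSucc j, ρ j := by
    intro A hA
    have hex : ∀ l, ∀ x : V l.castSucc, ∃ A' ∈ 𝒞 l,
        ‖x‖ ≤ ‖X‖ * (∏ j with Fin.castSucc j < l.castSucc, ρ j) →
          ‖F l x (A l) - F l x A'‖ ≤ layerScale a ρ c ε l := by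
      intro l x
      by_cases hx : ‖x‖ ≤ ‖X‖ * (∏ j with Fin.castSucc j < l.castSucc, ρ j)
      · obtain ⟨A', hA', h⟩ := happrox l (A l) (hA l) x hx
        exact ⟨A', hA', fun _ => h⟩
      · obtain ⟨A', hA'⟩ := hne l
        exact ⟨A', hA', fun h => absurd h hx⟩
    choose g hg hgx using hex
    obtain ⟨A', hA'⟩ := exists_chainNet_choice F g X
    have hmem : ∀ l, A' l ∈ 𝒞 l := fun l => by rw [hA']; exact hg _ _
    have hA'p : A' ∈ paramSet a := fun l => hball l _ (hmem l)
    refine ⟨A', Fintype.mem_piFinset.2 hmem, fun l => ?_⟩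
    refine (norm_chainNet_sub_le hρ hLip hA X (ε := ε)
      (α := fun l => layerWeight a ρ c l / ∑ i, layerWeight a ρ c i) (fun l => ?_) l).trans ?_
    · have := hgx l _ (norm_chainNet_le hρ hzero hLip hA'p X l.castSucc)
      rwa [← hA' l] at this
    · refine div_le_div_of_nonneg_right ?_ (Finset.prod_nonneg fun j _ => (hρ j).le)
      refine mul_le_of_le_one_right hε.le ?_
      refine (Finset.sum_le_univ_sum_of_nonneg fun i => div_nonneg (hw i) hW).trans ?_
      rw [← Finset.sum_div]
      exact div_self_le_one _
  refine ⟨⟨Fintype.piFinset 𝒞, fun A hA l => hball l _ (Fintype.mem_piFinset.1 hA l), hmain,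
    hlog⟩, ?_, ?_⟩
  · have hle := externalCoveringNumber_image_le (S := paramSet (B := B) a)
      (f := fun A => chainNet F A X (Fin.last L)) (𝒞 := Fintype.piFinset 𝒞) (ε := ε)
      fun A hA => by
        obtain ⟨A', hA', h⟩ := hmain A hA
        refine ⟨A', hA', (h (Fin.last L)).trans_eq ?_⟩
        simp [Fin.last_le_iff, Fin.castSucc_ne_last]
    obtain ⟨N, hN⟩ := ENat.ne_top_iff_exists.1 (ne_top_of_le_ne_top (ENat.natCast_ne_top _) hle)
    refine ⟨N, hN.symm, ?_⟩
    rw [← hN] at hle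
    have hle' : N ≤ (Fintype.piFinset 𝒞).card := by exact_mod_cast hle
    rcases Nat.eq_zero_or_pos N with rfl | hpos
    · refine le_trans ?_ hlog
      rw [Nat.cast_zero, Real.log_zero]
      exact Real.log_natCast_nonneg _
    · exact (Real.log_le_log (by exact_mod_cast hpos) (by exact_mod_cast hle')).trans hlog
  · have hK : 0 ≤ ‖X‖ ^ 2 * (∏ i, ρ i ^ 2) / ε ^ 2 :=
      div_nonneg (mul_nonneg (sq_nonneg _) (Finset.prod_nonneg fun i _ => sq_nonneg _))
        (sq_nonneg _)
    have hpow : (∑ l, layerWeight a ρ c l) ^ 3 ≤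
        (L : ℝ) ^ 2 * ∑ l, (Real.sqrt (c l) * a l / ρ l) ^ 2 := by
      rcases Nat.eq_zero_or_pos L with rfl | hL
      · simp
      have h := pow_sum_div_card_le_sum_pow (s := Finset.univ) (fun l _ => hw l) 2
      rw [Finset.card_univ, Fintype.card_fin, div_le_iff₀' (by positivity)] at h
      simpa only [layerWeight_pow_three ha hρ] using h
    calc _ ≤ ‖X‖ ^ 2 * (∏ i, ρ i ^ 2) / ε ^ 2 *
          ((L : ℝ) ^ 2 * ∑ l, (Real.sqrt (c l) * a l / ρ l) ^ 2) :=
          mul_le_mul_of_nonneg_left hpow hK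
      _ = _ := by ring

/-- At the zero activation a single parameter covers the layer. -/
theorem exists_cover_norm_le_zero {l : Fin L} (ha : 0 < a l)
    (hzero : ∀ A : B l, ‖A‖ ≤ a l → F l 0 A = 0) {M δ : ℝ} (hM : 0 ≤ M) (hδ : 0 ≤ δ) :
    ∃ 𝒞 : Finset (B l), (∀ A ∈ 𝒞, ‖A‖ ≤ a l) ∧ Real.log (𝒞.card : ℝ) ≤ M ∧
      ∀ A : B l, ‖A‖ ≤ a l → ∀ x : V l.castSucc, ‖x‖ ≤ 0 →
        ∃ A' ∈ 𝒞, ‖F l x A - F l x A'‖ ≤ δ := by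
  refine ⟨{0}, by simpa using ha.le, by simpa using hM, fun A hA x hx => ⟨0, by simp, ?_⟩⟩
  rw [norm_le_zero_iff.1 hx, hzero A hA, hzero 0 (by simpa using ha.le)]
  simpa using hδ

/-- A layer without entropy at any scale does not depend on its parameter. -/
theorem layer_eq_of_log_card_nonpos {l : Fin L} {b : ℝ} {x : V l.castSucc} (hx : ‖x‖ ≤ b)
    (h : ∀ δ : ℝ, 0 < δ → ∃ 𝒞 : Finset (B l), Real.log (𝒞.card : ℝ) ≤ 0 ∧
      ∀ A : B l, ‖A‖ ≤ a l → ∀ x : V l.castSucc, ‖x‖ ≤ b →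
        ∃ A' ∈ 𝒞, ‖F l x A - F l x A'‖ ≤ δ)
    {A A' : B l} (hA : ‖A‖ ≤ a l) (hA' : ‖A'‖ ≤ a l) : F l x A = F l x A' := by
  refine eq_of_norm_sub_le_zero (le_of_forall_pos_le_add fun δ hδ => ?_)
  obtain ⟨𝒞, hlog, h𝒞⟩ := h (δ / 2) (half_pos hδ)
  obtain ⟨D, hD, h1⟩ := h𝒞 A hA x hx
  obtain ⟨D', hD', h2⟩ := h𝒞 A' hA' x hx
  have hcard : 𝒞.card ≤ 1 := by
    by_contra! hlt
    exact hlog.not_gt (Real.log_pos (by exact_mod_cast hlt))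
  rw [Finset.card_le_one.1 hcard D' hD' D hD] at h2
  rw [norm_sub_rev] at h2
  have := norm_sub_le_norm_sub_add_norm_sub (F l x A) (F l x D) (F l x A')
  linarith

/-- Positive homogeneity transports a cover at scale `ε` to every scale. -/
theorem exists_cover_of_homogeneous [∀ l, NormedSpace ℝ (V l)] {l : Fin L} {K ε : ℝ}
    (hε : 0 < ε)
    (hhom : ∀ A : B l, ‖A‖ ≤ a l → ∀ t : ℝ, 0 < t → ∀ x : V l.castSucc,
      F l (t • x) A = t • F l x A)
    (hCov : ∀ b : ℝ, 0 < b → ∃ 𝒞 : Finset (B l), (∀ A ∈ 𝒞, ‖A‖ ≤ a l) ∧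
      Real.log (𝒞.card : ℝ) ≤ K * a l ^ 2 * b ^ 2 / ε ^ 2 ∧
      ∀ A : B l, ‖A‖ ≤ a l → ∀ x : V l.castSucc, ‖x‖ ≤ b →
        ∃ A' ∈ 𝒞, ‖F l x A - F l x A'‖ ≤ ε)
    {b δ : ℝ} (hb : 0 < b) (hδ : 0 < δ) :
    ∃ 𝒞 : Finset (B l), (∀ A ∈ 𝒞, ‖A‖ ≤ a l) ∧
      Real.log (𝒞.card : ℝ) ≤ K * a l ^ 2 * b ^ 2 / δ ^ 2 ∧
      ∀ A : B l, ‖A‖ ≤ a l → ∀ x : V l.castSucc, ‖x‖ ≤ b →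
        ∃ A' ∈ 𝒞, ‖F l x A - F l x A'‖ ≤ δ := by
  have ht : 0 < ε / δ := div_pos hε hδ
  obtain ⟨𝒞, hball, hlog, h𝒞⟩ := hCov (ε / δ * b) (mul_pos ht hb)
  refine ⟨𝒞, hball, hlog.trans_eq (by field_simp), fun A hA x hx => ?_⟩
  obtain ⟨A', hA', h⟩ := h𝒞 A hA ((ε / δ) • x) (by
    rw [norm_smul, Real.norm_of_nonneg ht.le]
    exact mul_le_mul_of_nonneg_left hx ht.le)
  refine ⟨A', hA', ?_⟩
  rw [hhom A hA _ ht, hhom A' (hball A' hA') _ ht, ← smul_sub, norm_smul,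
    Real.norm_of_nonneg ht.le, div_mul_eq_mul_div, div_le_iff₀ hδ] at h
  exact le_of_mul_le_mul_left h hε

end

theorem chaining_covering_bound
    (L : ℕ)
    (V : Fin (L + 1) → Type*) [∀ l, NormedAddCommGroup (V l)] [∀ l, NormedSpace ℝ (V l)]
    (B : Fin L → Type*) [∀ l, NormedAddCommGroup (B l)] [∀ l, NormedSpace ℝ (B l)]
    (a ρ : Fin L → ℝ) (ha : ∀ l, 0 < a l) (hρ : ∀ l, 0 < ρ l)
    (F : ∀ l : Fin L, V l.castSucc → B l → V l.succ)
    (hzero : ∀ l, ∀ A : B l, ‖A‖ ≤ a l → F l 0 A = 0)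
    (hLip : ∀ l, ∀ A : B l, ‖A‖ ≤ a l → ∀ x y : V l.castSucc,
      ‖F l x A - F l y A‖ ≤ ρ l * ‖x - y‖)
    (C : Fin L → ℝ → ℝ)
    (hCov : ∀ l, ∀ b : ℝ, 0 < b → ∀ δ : ℝ, 0 < δ → ∃ 𝒞 : Finset (B l),
      (∀ A ∈ 𝒞, ‖A‖ ≤ a l) ∧
      Real.log (𝒞.card : ℝ) ≤ C l δ * a l ^ 2 * b ^ 2 / δ ^ 2 ∧
      ∀ A : B l, ‖A‖ ≤ a l → ∀ x : V l.castSucc, ‖x‖ ≤ b →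
        ∃ A' ∈ 𝒞, ‖F l x A - F l x A'‖ ≤ δ)
    (X : V 0) (ε : ℝ) (hε : 0 < ε) :
    (∀ c : Fin L → ℝ, (∀ l, 0 < c l) → (∀ l, C l (layerScale a ρ c ε l) ≤ c l) →
      ChainingBound F a ρ X ε c) ∧
    ((∀ l, ∀ A : B l, ‖A‖ ≤ a l → ∀ t : ℝ, 0 < t → ∀ x : V l.castSucc,
        F l (t • x) A = t • F l x A) →
      ChainingBound F a ρ X ε (fun l => C l ε)) := by
  have hw := layerWeight_nonneg ha hρ
  have hM : ∀ c : Fin L → ℝ, ∀ l, 0 ≤ ‖X‖ ^ 2 * (∏ i, ρ i ^ 2) / ε ^ 2 *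
      (layerWeight a ρ c l * (∑ i, layerWeight a ρ c i) ^ 2) := fun c l =>
    mul_nonneg (div_nonneg (mul_nonneg (sq_nonneg _) (Finset.prod_nonneg fun i _ => sq_nonneg _))
      (sq_nonneg _)) (mul_nonneg (hw c l) (sq_nonneg _))
  have hscale : ∀ c : Fin L → ℝ, ∀ l, 0 ≤ layerScale a ρ c ε l := fun c l =>
    div_nonneg (mul_nonneg hε.le (div_nonneg (hw c l) (Finset.sum_nonneg fun i _ => hw c i)))
      (Finset.prod_nonneg fun j _ => (hρ j).le)
  have hb : X ≠ 0 → ∀ l : Fin L, 0 < ‖X‖ * ∏ j with Fin.castSucc j < l.castSucc, ρ j :=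
    fun hX l => mul_pos (norm_pos_iff.2 hX) (Finset.prod_pos fun j _ => hρ j)
  refine ⟨fun c hc hCc => ?_, fun hhom => ?_⟩
  · refine chainingBound_of_layer_covers ha hρ hzero hLip X hε c fun l => ?_
    by_cases hX : X = 0
    · simpa only [hX, norm_zero, zero_mul] using exists_cover_norm_le_zero (F := F) (ha l)
        (hzero l) (hM c l) (hscale c l)
    have hδ := layerScale_pos ha hρ hε (hc l)
    obtain ⟨𝒞, hball, hlog, h𝒞⟩ := hCov l _ (hb hX l) _ hδ
    refine ⟨𝒞, hball, hlog.trans ?_, h𝒞⟩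
    rw [← entropy_layerScale ha hρ hε (hc l)]
    gcongr
    exact hCc l
  · have hC : ∀ l, 0 ≤ C l ε := fun l => by
      obtain ⟨𝒞, -, hlog, -⟩ := hCov l 1 one_pos ε hε
      have h0 := (Real.log_natCast_nonneg _).trans hlog
      have hpos : 0 < a l ^ 2 / ε ^ 2 := div_pos (pow_pos (ha l) 2) (pow_pos hε 2)
      refine nonneg_of_mul_nonneg_left (h0.trans_eq ?_) hpos
      ring
    refine chainingBound_of_layer_covers ha hρ hzero hLip X hε _ fun l => ?_
    by_cases hX : X = 0
    · simpa only [hX, norm_zero, zero_mul] using exists_cover_norm_le_zero (F := F) (ha l)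
        (hzero l) (hM (fun l => C l ε) l) (hscale _ l)
    have hcov := fun δ (hδ : 0 < δ) => exists_cover_of_homogeneous hε (hhom l)
      (fun b hb => hCov l b hb ε hε) (hb hX l) hδ
    rcases (hC l).eq_or_lt with h0 | hpos
    · refine ⟨{0}, by simpa using (ha l).le, by simpa using hM (fun l => C l ε) l,
        fun A hA x hx => ⟨0, by simp, ?_⟩⟩
      rw [layer_eq_of_log_card_nonpos (F := F) hx (fun δ hδ => ?_) hA
        (by simpa using (ha l).le : ‖(0 : B l)‖ ≤ a l), sub_self, norm_zero]
      · exact hscale _ l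
      · obtain ⟨𝒞, -, hlog, h𝒞⟩ := hcov δ hδ
        exact ⟨𝒞, by simpa [← h0] using hlog, h𝒞⟩
    · obtain ⟨𝒞, hball, hlog, h𝒞⟩ := hcov _ (layerScale_pos ha hρ hε (c := fun l => C l ε) hpos)
      exact ⟨𝒞, hball, hlog.trans_eq
        (entropy_layerScale ha hρ hε (c := fun l => C l ε) hpos ‖X‖), h𝒞⟩
end

section
/- Let $\{R_{\mathcal N}\}$ be a family of real random variables indexed by a parameter $\mathcal N$, jointly defined on one probability space, and let $\gamma_1(\mathcal N),\dots,\gamma_l(\mathcal N),N_1(\mathcal N),\dots,N_L(\mathcal N)$ be positive statistics of $\mathcal N$. Suppose there are a function $f:(0,\infty)^{l+L}\to\mathbb R$, monotonically decreasing in each of its first $l$ arguments and monotonically increasing in each of its last $L$ arguments, and constants $C_1,C_2>0$, such that for every choice of $\gamma_1,\dots,\gamma_l,N_1,\dots,N_L>0$ and every $\delta>0$, with probability at least $1-\delta$, every $\mathcal N$ with $\gamma_i(\mathcal N)\ge\gamma_i$ for all $i\le l$ and $N_i(\mathcal N)\le N_i$ for all $i\le L$ satisfies $$R_{\mathcal N}\le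 f(\gamma_1,\dots,\gamma_l,N_1,\dots,N_L)+C_1\sqrt{\frac{\log(1/\delta)}{C_2}}.$$ Fix $\beta_1,\dots,\beta_L>0$ and positive integers $\kappa_1,\dots,\kappa_l$, and write $\bar\gamma_i(\mathcal N)=\min(\gamma_i(\mathcal N),\kappa_i)$ (so $\bar\gamma_i(\mathcal N)=\gamma_i(\mathcal N)$ whenever $\gamma_i(\mathcal N)\le\kappa_i$). Then for any $\delta>0$, with probability at least $1-\delta$, every $\mathcal N$ satisfies $$R_{\mathcal N}\le f\Big(\min\big(\tfrac{\bar\gamma_1(\mathcal N)}2,\tfrac1{\kappa_1}\big),\dots,\min\big(\tfrac{\bar\gamma_l(\mathcal N)}2,\tfrac1{\kappa_l}\big),N_1(\mathcal N)+\beta_1,\dots,N_L(\mathcal N)+\beta_L\Big)+\frac{C_1}{\sqrt{C_2}}\sqrt{\log\frac1\delta+\sum_{i=1}^l\log\frac{2\kappa_i}{\bar\gamma_i(\mathcal N)}+2\sum_{i=1}^L\log\Big(2+\frac{N_i(\mathcal N)}{\beta_i}\Big)}.$$ Here "with probability at least $p$, a property holds" means that the property holds on some measurable event of probability at least $p$.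 -/
open MeasureTheory

/-- "With probability at least `p`, the property `E` holds": some measurable event of probability
at least `p` is contained in `E`. If `E` itself is measurable this is just `p ≤ ℙ E`; the
formulation matters only because `E` may be an uncountable intersection of events. -/
def WithProbAtLeast {Ω : Type*} [MeasurableSpace Ω] (ℙ : Measure Ω) (p : ℝ)
    (E : Ω → Prop) : Prop :=
  ∃ A : Set Ω, MeasurableSet A ∧ (∀ ω ∈ A, E ω) ∧ p ≤ ℙ.real A

/-- Countable union bound: if the property `E i` fails with probability at most `δ * w i`, and
the weights `w` sum to at most one, then all the `E i` hold simultaneously with probability at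
least `1 - δ`. -/
theorem WithProbAtLeast.forall_of_countable {Ω I : Type*} [MeasurableSpace Ω] [Countable I]
    {ℙ : Measure Ω} [IsProbabilityMeasure ℙ] {δ : ℝ} (hδ : 0 ≤ δ) {w : I → ℝ}
    (hw : ∀ i, 0 ≤ w i) (hsum : ∀ s : Finset I, ∑ i ∈ s, w i ≤ 1) {E : I → Ω → Prop}
    (h : ∀ i, WithProbAtLeast ℙ (1 - δ * w i) (E i)) :
    WithProbAtLeast ℙ (1 - δ) fun ω => ∀ i, E i ω := by
  choose A hA hE hp using h
  refine ⟨⋂ i, A i, MeasurableSet.iInter hA, fun ω hω i => hE i ω (Set.mem_iInter.1 hω i), ?_⟩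
  have hcompl : ∀ i, ℙ (A i)ᶜ ≤ ENNReal.ofReal (δ * w i) := fun i => by
    rw [← ofReal_measureReal, probReal_compl_eq_one_sub (hA i)]
    exact ENNReal.ofReal_le_ofReal (by linarith [hp i])
  have hbound : ℙ (⋂ i, A i)ᶜ ≤ ENNReal.ofReal δ := by
    rw [Set.compl_iInter]
    refine (measure_iUnion_le _).trans ((ENNReal.tsum_le_tsum hcompl).trans ?_)
    rw [ENNReal.tsum_eq_iSup_sum]
    refine iSup_le fun s => ?_
    rw [← ENNReal.ofReal_sum_of_nonneg fun i _ => mul_nonneg hδ (hw i), ← Finset.mul_sum]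
    exact ENNReal.ofReal_le_ofReal (mul_le_of_le_one_right hδ (hsum s))
  have hreal := ENNReal.toReal_le_of_le_ofReal hδ hbound
  rw [← measureReal_def, probReal_compl_eq_one_sub (MeasurableSet.iInter hA)] at hreal
  linarith

/-- A finite product of subprobability weights is a subprobability weight on the product type. -/
theorem sum_prod_weights_le_one {ι α : Type*} [Fintype ι] {w : ι → α → ℝ}
    (hw : ∀ i a, 0 ≤ w i a) (hsum : ∀ i (s : Finset α), ∑ a ∈ s, w i a ≤ 1)
    (s : Finset (ι → α)) : ∑ p ∈ s, ∏ i, w i (p i) ≤ 1 := by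
  classical
  have hsub : s ⊆ Fintype.piFinset fun i => s.image fun p => p i := fun p hp =>
    Fintype.mem_piFinset.2 fun i => Finset.mem_image_of_mem (fun p => p i) hp
  refine (Finset.sum_le_sum_of_subset_of_nonneg hsub fun p _ _ =>
    Finset.prod_nonneg fun i _ => hw i _).trans ?_
  rw [← Finset.prod_univ_sum]
  exact Finset.prod_le_one (fun i _ => Finset.sum_nonneg fun a _ => hw i a) fun i _ => hsum i _

theorem sum_le_one_of_sum_range {w : ℕ → ℝ} (hw : ∀ n, 0 ≤ w n)
    (h : ∀ n, ∑ k ∈ Finset.range n, w k ≤ 1) (s : Finset ℕ) : ∑ k ∈ s, w k ≤ 1 := by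
  obtain ⟨n, hn⟩ := s.exists_nat_subset_range
  exact (Finset.sum_le_sum_of_subset_of_nonneg hn fun k _ _ => hw k).trans (h n)

theorem sum_inv_two_pow_succ_le_one (s : Finset ℕ) :
    ∑ k ∈ s, ((2 : ℝ) ^ (k + 1))⁻¹ ≤ 1 := by
  refine sum_le_one_of_sum_range (fun n => by positivity) (fun n => ?_) s
  have h : ∑ k ∈ Finset.range n, ((2 : ℝ) ^ (k + 1))⁻¹ = 1 - ((2 : ℝ) ^ n)⁻¹ := by
    induction n with
    | zero => simp
    | succ n ih => rw [Finset.sum_range_succ, ih]; field_simp; ring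
  rw [h]
  exact sub_le_self _ (by positivity)

theorem sum_inv_succ_mul_le_one (s : Finset ℕ) :
    ∑ k ∈ s, (((k : ℝ) + 1) * (k + 2))⁻¹ ≤ 1 := by
  refine sum_le_one_of_sum_range (fun n => by positivity) (fun n => ?_) s
  have h : ∑ k ∈ Finset.range n, (((k : ℝ) + 1) * (k + 2))⁻¹ = 1 - ((n : ℝ) + 1)⁻¹ := by
    induction n with
    | zero => simp
    | succ n ih => rw [Finset.sum_range_succ, ih]; push_cast; field_simp; ring
  rw [h]
  exact sub_le_self _ (by positivity)

/-- Dyadic rounding down of `x ∈ (0, K]`, losing a factor of at most two. -/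
theorem exists_dyadic_le {x K : ℝ} (hx : 0 < x) (hxK : x ≤ K) :
    ∃ j : ℕ, K / 2 ^ (j + 1) ≤ x ∧ x / 2 ≤ K / 2 ^ (j + 1) ∧ (2 : ℝ) ^ (j + 1) ≤ 2 * K / x := by
  obtain ⟨j, hj, hj'⟩ := exists_nat_pow_near ((one_le_div hx).2 hxK) (one_lt_two : (1 : ℝ) < 2)
  rw [le_div_iff₀ hx] at hj
  rw [div_lt_iff₀ hx] at hj'
  refine ⟨j, ?_, ?_, ?_⟩
  · rw [div_le_iff₀ (by positivity)]; linarith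
  · rw [le_div_iff₀ (by positivity), pow_succ]; linarith
  · rw [le_div_iff₀ hx, pow_succ]; linarith

/-- Rounding up of `x > 0` to a positive multiple of `b`. -/
theorem exists_multiple_ge {x b : ℝ} (hx : 0 < x) (hb : 0 < b) :
    ∃ k : ℕ, x ≤ b * (k + 1) ∧ b * (k + 1) ≤ x + b ∧
      ((k : ℝ) + 1) * (k + 2) ≤ (2 + x / b) ^ 2 := by
  have hxb : 0 ≤ x / b := by positivity
  have hle := Nat.floor_le hxb
  have hlt := Nat.lt_floor_add_one (x / b)
  refine ⟨⌊x / b⌋₊, ?_, ?_, ?_⟩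
  · rw [div_lt_iff₀ hb] at hlt; linarith
  · rw [le_div_iff₀ hb] at hle; linarith
  · rw [sq]
    gcongr ?_ * ?_ <;> linarith

theorem union_bound_post_hoc
    {Ω : Type*} [MeasurableSpace Ω] (ℙ : Measure Ω) [IsProbabilityMeasure ℙ]
    {Param : Type*} (l L : ℕ)
    (R : Param → Ω → ℝ)
    (γ : Fin l → Param → ℝ) (N : Fin L → Param → ℝ)
    (hγ : ∀ i 𝒩, 0 < γ i 𝒩) (hN : ∀ i 𝒩, 0 < N i 𝒩)
    (f : (Fin l → ℝ) → (Fin L → ℝ) → ℝ)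
    (hf_anti : ∀ n : Fin L → ℝ, (∀ i, 0 < n i) →
      AntitoneOn (fun g => f g n) {g : Fin l → ℝ | ∀ i, 0 < g i})
    (hf_mono : ∀ g : Fin l → ℝ, (∀ i, 0 < g i) →
      MonotoneOn (fun n => f g n) {n : Fin L → ℝ | ∀ i, 0 < n i})
    (C₁ C₂ : ℝ) (hC₁ : 0 < C₁) (hC₂ : 0 < C₂)
    (H : ∀ (g : Fin l → ℝ) (n : Fin L → ℝ), (∀ i, 0 < g i) → (∀ i, 0 < n i) →
      ∀ δ : ℝ, 0 < δ →
        WithProbAtLeast ℙ (1 - δ) fun ω =>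
          ∀ 𝒩 : Param, (∀ i, g i ≤ γ i 𝒩) → (∀ i, N i 𝒩 ≤ n i) →
            R 𝒩 ω ≤ f g n + C₁ * Real.sqrt (Real.log (1 / δ) / C₂))
    (β : Fin L → ℝ) (hβ : ∀ i, 0 < β i)
    (κ : Fin l → ℕ) (hκ : ∀ i, 0 < κ i)
    (δ : ℝ) (hδ : 0 < δ) :
    WithProbAtLeast ℙ (1 - δ) fun ω =>
      ∀ 𝒩 : Param,
        R 𝒩 ω ≤
          f (fun i => min (min (γ i 𝒩) (κ i : ℝ) / 2) (1 / (κ i : ℝ)))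
            (fun i => N i 𝒩 + β i) +
          C₁ / Real.sqrt C₂ *
            Real.sqrt (Real.log (1 / δ) +
              ∑ i, Real.log (2 * (κ i : ℝ) / min (γ i 𝒩) (κ i : ℝ)) +
              2 * ∑ i, Real.log (2 + N i 𝒩 / β i)) := by
  let w : Fin l ⊕ Fin L → ℕ → ℝ :=
    Sum.elim (fun _ k => ((2 : ℝ) ^ (k + 1))⁻¹) (fun _ k => (((k : ℝ) + 1) * (k + 2))⁻¹)
  have hw : ∀ i k, 0 < w i k := by
    rintro (i | i) k <;> simp only [w, Sum.elim_inl, Sum.elim_inr] <;> positivity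
  have hwsum : ∀ i (s : Finset ℕ), ∑ k ∈ s, w i k ≤ 1 := by
    rintro (i | i) s
    · exact sum_inv_two_pow_succ_le_one s
    · exact sum_inv_succ_mul_le_one s
  let g : (Fin l ⊕ Fin L → ℕ) → Fin l → ℝ := fun p i => κ i / 2 ^ (p (.inl i) + 1)
  let n : (Fin l ⊕ Fin L → ℕ) → Fin L → ℝ := fun p i => β i * (p (.inr i) + 1)
  have hκ' : ∀ i, (0 : ℝ) < κ i := fun i => Nat.cast_pos.2 (hκ i)
  have hg : ∀ p i, 0 < g p i := fun p i => div_pos (hκ' i) (by positivity)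
  have hn : ∀ p i, 0 < n p i := fun p i => mul_pos (hβ i) (by positivity)
  have hwp : ∀ p : Fin l ⊕ Fin L → ℕ, 0 < ∏ i, w i (p i) := fun p =>
    Finset.prod_pos fun i _ => hw i _
  obtain ⟨A, hA, hAE, hAp⟩ := WithProbAtLeast.forall_of_countable hδ.le
    (fun p => (hwp p).le) (sum_prod_weights_le_one (fun i k => (hw i k).le) hwsum)
    (fun p => H (g p) (n p) (hg p) (hn p) _ (mul_pos hδ (hwp p)))
  refine ⟨A, hA, fun ω hω 𝒩 => ?_, hAp⟩
  have hm : ∀ i, 0 < min (γ i 𝒩) (κ i : ℝ) := fun i => lt_min (hγ i 𝒩) (hκ' i)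
  choose j hj_le hj_ge hj_pow using fun i => exists_dyadic_le (hm i) (min_le_right _ _)
  choose k hk_ge hk_le hk_mul using fun i => exists_multiple_ge (hN i 𝒩) (hβ i)
  let p : Fin l ⊕ Fin L → ℕ := Sum.elim j k
  have hlog : Real.log (1 / (δ * ∏ i, w i (p i))) ≤ Real.log (1 / δ) +
      ∑ i, Real.log (2 * (κ i : ℝ) / min (γ i 𝒩) (κ i : ℝ)) +
      2 * ∑ i, Real.log (2 + N i 𝒩 / β i) := by
    have hsplit : Real.log (1 / (δ * ∏ i, w i (p i))) = Real.log (1 / δ) +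
        ∑ i, Real.log ((2 : ℝ) ^ (j i + 1)) + ∑ i, Real.log (((k i : ℝ) + 1) * (k i + 2)) := by
      rw [one_div, one_div, Real.log_inv, Real.log_inv, Real.log_mul hδ.ne' (hwp p).ne',
        Real.log_prod fun i _ => (hw i _).ne', Fintype.sum_sum_type]
      simp only [w, p, Sum.elim_inl, Sum.elim_inr, Real.log_inv, Finset.sum_neg_distrib]
      ring
    rw [hsplit, Finset.mul_sum]
    gcongr with i _ i _
    · exact hj_pow i
    · rw [← Nat.cast_two, ← Real.log_pow]
      exact Real.log_le_log (by positivity) (by exact_mod_cast hk_mul i)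
  refine (hAE ω hω p 𝒩 (fun i => (hj_le i).trans (min_le_left _ _)) hk_ge).trans
    (add_le_add ?_ ?_)
  · have hmin : ∀ i, 0 < min (min (γ i 𝒩) (κ i : ℝ) / 2) (1 / (κ i : ℝ)) := fun i =>
      lt_min (half_pos (hm i)) (one_div_pos.2 (hκ' i))
    exact (hf_anti (n p) (hn p) hmin (hg p) fun i => (min_le_left _ _).trans (hj_ge i)).trans
      (hf_mono _ hmin (hn p) (fun i => add_pos (hN i 𝒩) (hβ i)) hk_le)
  · rw [Real.sqrt_div' _ hC₂.le, mul_div_assoc', div_mul_eq_mul_div]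
    gcongr
end
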